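/- arXiv:1608.01563 — 6 statements merged into one kernel-verified Lean document; each statement's English description precedes it below -/
import Mathlib

section
/- For all integers n ≥ b ≥ 1, the number of (n,b)-domino towers equals the binomial coefficient C(2n−1, n−b). -/
/-- `T` is an (n,b)-domino tower: a finite set of pairs `(x, y)` where `(x, y) ∈ T` means a
horizontal 1×2 domino occupies columns `x` and `x+1` at level `y`. -/
def IsDominoTower (n b : ℕ) (T : Finset (ℤ × ℕ)) : Prop :=
  T.card = n ∧
  (∀ x : ℤ, (x, 0) ∈ T ↔ ∃ i : ℕ, i < b ∧ x = 2 * (i : ℤ)) ∧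
  (∀ x x' : ℤ, ∀ y : ℕ, (x, y) ∈ T → (x', y) ∈ T → x ≠ x' → 2 ≤ |x - x'|) ∧
  (∀ x : ℤ, ∀ y : ℕ, (x, y + 1) ∈ T → ∃ x' : ℤ, (x', y) ∈ T ∧ |x - x'| ≤ 1)

namespace DomTower

/-- A heap of dominoes, with no condition on the base. -/
def Heap (T : Finset (ℤ × ℕ)) : Prop :=
  (∀ x x' : ℤ, ∀ y : ℕ, (x, y) ∈ T → (x', y) ∈ T → x ≠ x' → 2 ≤ |x - x'|) ∧
  (∀ x : ℤ, ∀ y : ℕ, (x, y + 1) ∈ T → ∃ x' : ℤ, (x', y) ∈ T ∧ |x - x'| ≤ 1)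

def height (T : Finset (ℤ × ℕ)) (x : ℤ) : ℕ :=
  (T.filter (fun p => |p.1 - x| ≤ 1)).sup (fun p => p.2 + 1)

def drop (x : ℤ) (T : Finset (ℤ × ℕ)) : Finset (ℤ × ℕ) := insert (x, height T x) T

def build : List ℤ → Finset (ℤ × ℕ)
  | [] => ∅
  | x :: w => drop x (build w)

/-- Words (head is the last letter) descending by at most one at each step. -/
def Valid : List ℤ → Prop
  | [] => True
  | [_] => True
  | x :: y :: w => y - 1 ≤ x ∧ Valid (y :: w)

def Maxl (T : Finset (ℤ × ℕ)) (x : ℤ) (y : ℕ) : Prop :=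
  (x, y) ∈ T ∧ ∀ x' : ℤ, ∀ y' : ℕ, (x', y') ∈ T → |x' - x| ≤ 1 → y' ≤ y

def Cov (T : Finset (ℤ × ℕ)) (x : ℤ) : Prop := ∃ x' : ℤ, ∃ y : ℕ, (x', y) ∈ T ∧ |x' - x| ≤ 1

lemma lt_height {T : Finset (ℤ × ℕ)} {x x' : ℤ} {y : ℕ} (h : (x', y) ∈ T) (hx : |x' - x| ≤ 1) :
    y < height T x := by
  have := Finset.le_sup (f := fun p : ℤ × ℕ => p.2 + 1)
    (show (x', y) ∈ T.filter (fun p => |p.1 - x| ≤ 1) by simp [h, hx])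
  exact this

lemma height_succ {T : Finset (ℤ × ℕ)} {x : ℤ} {y : ℕ} (h : height T x = y + 1) :
    ∃ x' : ℤ, (x', y) ∈ T ∧ |x' - x| ≤ 1 := by
  have hne : (T.filter (fun p => |p.1 - x| ≤ 1)).Nonempty := by
    by_contra hc
    rw [Finset.not_nonempty_iff_eq_empty] at hc
    simp [height, hc] at h
  obtain ⟨p, hp, he⟩ := Finset.exists_mem_eq_sup _ hne (fun p : ℤ × ℕ => p.2 + 1)
  rw [Finset.mem_filter] at hp
  have : p.2 = y := by
    unfold height at h
    omega
  exact ⟨p.1, by rw [← this]; exact hp.1, hp.2⟩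

lemma height_le {T : Finset (ℤ × ℕ)} {x : ℤ} {n : ℕ}
    (h : ∀ x' y, (x', y) ∈ T → |x' - x| ≤ 1 → y < n) : height T x ≤ n := by
  refine Finset.sup_le ?_
  rintro ⟨a, c⟩ hp
  rw [Finset.mem_filter] at hp
  exact h a c hp.1 hp.2

lemma height_zero_iff {T : Finset (ℤ × ℕ)} {x : ℤ} : height T x = 0 ↔ ¬ Cov T x := by
  constructor
  · rintro h ⟨x', y, h1, h2⟩
    have := lt_height h1 h2
    omega
  · intro h
    have := height_le (T := T) (x := x) (n := 0) (fun x' y h1 h2 => (h ⟨x', y, h1, h2⟩).elim)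
    omega

lemma new_notMem (T : Finset (ℤ × ℕ)) (x : ℤ) : (x, height T x) ∉ T := by
  intro h
  have := lt_height (x := x) h (by simp)
  omega

lemma mem_drop {T : Finset (ℤ × ℕ)} {a x : ℤ} {y : ℕ} :
    (x, y) ∈ drop a T ↔ (x = a ∧ y = height T a) ∨ (x, y) ∈ T := by
  simp [drop]

lemma card_drop (T : Finset (ℤ × ℕ)) (x : ℤ) : (drop x T).card = T.card + 1 :=
  Finset.card_insert_of_notMem (new_notMem T x)

lemma card_build (w : List ℤ) : (build w).card = w.length := by
  induction w with
  | nil => rfl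
  | cons x w ih => simp [build, card_drop, ih]

lemma heap_drop {T : Finset (ℤ × ℕ)} (h : Heap T) (a : ℤ) : Heap (drop a T) := by
  constructor
  · intro x x' y h1 h2 hne
    rw [mem_drop] at h1 h2
    rcases h1 with ⟨rfl, rfl⟩ | h1 <;> rcases h2 with ⟨rfl, h3⟩ | h2
    · exact absurd rfl hne
    · by_contra hc
      have := lt_height (x := x) h2 (by rw [abs_sub_comm]; omega)
      omega
    · by_contra hc
      have := lt_height (x := x') h1 (by omega)
      omega
    · exact h.1 x x' y h1 h2 hne
  · intro x y h1
    rw [mem_drop] at h1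
    rcases h1 with ⟨rfl, h2⟩ | h1
    · obtain ⟨x', h3, h4⟩ := height_succ h2.symm
      exact ⟨x', mem_drop.2 (Or.inr h3), by rw [abs_sub_comm]; exact h4⟩
    · obtain ⟨x', h3, h4⟩ := h.2 x y h1
      exact ⟨x', mem_drop.2 (Or.inr h3), h4⟩

lemma heap_build (w : List ℤ) : Heap (build w) := by
  induction w with
  | nil => constructor <;> simp [build]
  | cons x w ih => exact heap_drop ih x

lemma maxl_new (T : Finset (ℤ × ℕ)) (a : ℤ) : Maxl (drop a T) a (height T a) := by
  refine ⟨mem_drop.2 (Or.inl ⟨rfl, rfl⟩), fun x' y' h1 h2 => ?_⟩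
  rw [mem_drop] at h1
  rcases h1 with ⟨_, h⟩ | h
  · exact h.le
  · exact (lt_height h h2).le

lemma maxl_build_le {a : ℤ} {w : List ℤ} (h : Valid (a :: w)) {x : ℤ} {y : ℕ}
    (hm : Maxl (build (a :: w)) x y) : x ≤ a := by
  induction w generalizing a x y with
  | nil =>
    have := hm.1
    simp only [build, mem_drop] at this
    simp at this
    omega
  | cons c w ih =>
    obtain ⟨h1, h2⟩ := h
    have hm1 := hm.1
    rw [build, mem_drop] at hm1
    rcases hm1 with ⟨rfl, _⟩ | hm1
    · exact le_rfl
    · have := ih h2 (x := x) (y := y) ⟨hm1, fun x' y' h3 h4 => hm.2 x' y' (by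
        rw [build, mem_drop]; exact Or.inr h3) h4⟩
      by_contra hc
      have hx : |x - a| ≤ 1 := by rw [abs_le]; omega
      have h5 := lt_height (x := a) hm1 hx
      have h6 := hm.2 a _ (maxl_new _ a).1 (by rw [abs_sub_comm]; exact hx)
      omega

lemma valid_tail {a : ℤ} {w : List ℤ} (h : Valid (a :: w)) : Valid w := by
  cases w with
  | nil => trivial
  | cons c w => exact h.2

lemma build_inj {w w' : List ℤ} (h : Valid w) (h' : Valid w') (he : build w = build w') :
    w = w' := by
  induction w generalizing w' with
  | nil =>
    have := congrArg Finset.card he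
    rw [card_build, card_build] at this
    exact (List.length_eq_zero_iff.1 this.symm).symm
  | cons a w ih =>
    cases w' with
    | nil =>
      have := congrArg Finset.card he
      rw [card_build, card_build] at this
      simp at this
    | cons a' w' =>
      have m1 : Maxl (build (a :: w)) a (height (build w) a) := maxl_new _ a
      have m2 : Maxl (build (a' :: w')) a' (height (build w') a') := maxl_new _ a'
      have l1 := maxl_build_le h' (he ▸ m1)
      have l2 := maxl_build_le h (he.symm ▸ m2)
      obtain rfl : a = a' := le_antisymm l1 l2
      have e1 := m1.2 a _ (he ▸ m2.1) (by simp)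
      have e2 := m2.2 a _ (he ▸ m1.1) (by simp)
      have e : height (build w) a = height (build w') a := le_antisymm e2 e1
      have hT : build w = build w' := by
        have q1 : (build (a :: w)).erase (a, height (build w) a) = build w :=
          Finset.erase_insert (new_notMem _ _)
        have q2 : (build (a :: w')).erase (a, height (build w') a) = build w' :=
          Finset.erase_insert (new_notMem _ _)
        rw [← q1, ← q2, he, e]
      rw [ih (valid_tail h) (valid_tail h') hT]

lemma exists_maxl {T : Finset (ℤ × ℕ)} (hne : T.Nonempty) :
    ∃ x y, Maxl T x y ∧ ∀ x' y', Maxl T x' y' → x' ≤ x := by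
  classical
  obtain ⟨p, hp, hmax⟩ := Finset.exists_max_image T (fun p => p.2) hne
  have hS : (T.filter (fun p => Maxl T p.1 p.2)).Nonempty :=
    ⟨p, Finset.mem_filter.2 ⟨hp, hp, fun x' y' h _ => hmax (x', y') h⟩⟩
  obtain ⟨q, hq, hqm⟩ := Finset.exists_max_image _ (fun p => p.1) hS
  refine ⟨q.1, q.2, (Finset.mem_filter.1 hq).2, fun x' y' h => ?_⟩
  exact hqm (x', y') (Finset.mem_filter.2 ⟨h.1, h⟩)

lemma build_surj (n : ℕ) : ∀ T : Finset (ℤ × ℕ), T.card = n → Heap T →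
    ∃ w, Valid w ∧ build w = T := by
  induction n with
  | zero =>
    intro T hT _
    exact ⟨[], trivial, (Finset.card_eq_zero.1 hT).symm⟩
  | succ n ih =>
    intro T hT hH
    obtain ⟨x, y, hm, hr⟩ := exists_maxl (T := T) (by rw [← Finset.card_pos]; omega)
    have hlt : ∀ x' y', (x', y') ∈ T.erase (x, y) → |x' - x| ≤ 1 → y' < y := by
      intro x' y' h1 h2
      rw [Finset.mem_erase] at h1
      have := hm.2 x' y' h1.2 h2
      rcases this.lt_or_eq with h | rfl
      · exact h
      · have hx : x' ≠ x := fun e => h1.1 (by rw [e])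
        have := hH.1 x' x y' h1.2 hm.1 hx
        omega
    have hheight : height (T.erase (x, y)) x = y := by
      apply le_antisymm (height_le hlt)
      cases y with
      | zero => simp
      | succ y =>
        obtain ⟨x', h1, h2⟩ := hH.2 x y hm.1
        exact lt_height (x' := x') (Finset.mem_erase.2 ⟨by simp, h1⟩)
          (by rw [abs_sub_comm]; exact h2)
    have hHe : Heap (T.erase (x, y)) := by
      constructor
      · intro a a' c h1 h2
        exact hH.1 a a' c (Finset.mem_of_mem_erase h1) (Finset.mem_of_mem_erase h2)
      · intro a c h1
        obtain ⟨a', h2, h3⟩ := hH.2 a c (Finset.mem_of_mem_erase h1)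
        refine ⟨a', Finset.mem_erase.2 ⟨?_, h2⟩, h3⟩
        intro e
        obtain ⟨rfl, rfl⟩ := Prod.mk.inj e
        have := hm.2 a _ (Finset.mem_of_mem_erase h1) h3
        omega
    obtain ⟨w, hw, hb⟩ := ih (T.erase (x, y)) (by rw [Finset.card_erase_of_mem hm.1]; omega) hHe
    have hbT : build (x :: w) = T := by
      rw [build, hb, drop, hheight, Finset.insert_erase hm.1]
    refine ⟨x :: w, ?_, hbT⟩
    cases w with
    | nil => trivial
    | cons c w =>
      refine ⟨?_, hw⟩
      by_contra hc
      have m1 : Maxl (build (c :: w)) c (height (build w) c) := maxl_new _ c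
      have : Maxl T c (height (build w) c) := by
        refine ⟨?_, ?_⟩
        · have := m1.1
          rw [hb] at this
          exact Finset.mem_of_mem_erase this
        · intro x' y' h1 h2
          apply m1.2 x' y' _ h2
          rw [hb, Finset.mem_erase]
          refine ⟨?_, h1⟩
          intro e
          obtain ⟨rfl, rfl⟩ := Prod.mk.inj e
          rw [abs_le] at h2
          omega
      have := hr _ _ this
      omega

/-- Base is `{0, 2, …, 2(b-1)}`. -/
def Base (b : ℕ) (T : Finset (ℤ × ℕ)) : Prop :=
  ∀ x : ℤ, (x, 0) ∈ T ↔ ∃ i : ℕ, i < b ∧ x = 2 * (i : ℤ)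

lemma base_drop_cov {T : Finset (ℤ × ℕ)} {a : ℤ} (h : Cov T a) (x : ℤ) :
    (x, 0) ∈ drop a T ↔ (x, 0) ∈ T := by
  have : height T a ≠ 0 := fun e => height_zero_iff.1 e h
  rw [mem_drop]
  constructor
  · rintro (⟨_, e⟩ | h)
    · exact absurd e.symm this
    · exact h
  · exact Or.inr

lemma base_drop_not_cov {T : Finset (ℤ × ℕ)} {a : ℤ} (h : ¬ Cov T a) (x : ℤ) :
    (x, 0) ∈ drop a T ↔ x = a ∨ (x, 0) ∈ T := by
  rw [mem_drop, height_zero_iff.2 h]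
  simp

lemma cov_mono {T : Finset (ℤ × ℕ)} {a x : ℤ} (h : Cov T x) : Cov (drop a T) x := by
  obtain ⟨x', y, h1, h2⟩ := h
  exact ⟨x', y, mem_drop.2 (Or.inr h1), h2⟩

lemma cov_new {T : Finset (ℤ × ℕ)} {a x : ℤ} (h : |a - x| ≤ 1) : Cov (drop a T) x :=
  ⟨a, _, (maxl_new T a).1, h⟩

lemma build_mono {w v : List ℤ} : build w ⊆ build (v ++ w) := by
  induction v with
  | nil => simp
  | cons a v ih =>
    intro p hp
    exact Finset.mem_insert_of_mem (ih hp)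

lemma valid_append {v w : List ℤ} (h : Valid (v ++ w)) : Valid w := by
  induction v with
  | nil => exact h
  | cons a v ih => exact ih (valid_tail h)

lemma blocked {g m : ℤ} {w : List ℤ} (h0 : (g, 0) ∉ build (m :: w))
    (hc : Cov (build (m :: w)) g ∨ g + 2 ≤ m) (v : List ℤ) (hv : Valid (v ++ m :: w)) :
    (g, 0) ∉ build (v ++ m :: w) ∧ (Cov (build (v ++ m :: w)) g ∨
      ∃ c t, v ++ m :: w = c :: t ∧ g + 2 ≤ c) := by
  induction v with
  | nil =>
    refine ⟨h0, ?_⟩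
    rcases hc with hc | hc
    · exact Or.inl hc
    · exact Or.inr ⟨m, w, rfl, hc⟩
  | cons a v ih =>
    obtain ⟨i1, i2⟩ := ih (valid_tail hv)
    simp only [List.cons_append, build] at *
    rcases i2 with i2 | ⟨c, t, e, hct⟩
    · refine ⟨?_, Or.inl (cov_mono i2)⟩
      rw [mem_drop]
      rintro (⟨rfl, e⟩ | h)
      · exact height_zero_iff.1 e.symm i2
      · exact i1 h
    · have hca : c - 1 ≤ a := by
        rw [e] at hv
        exact hv.1
      refine ⟨?_, ?_⟩
      · rw [mem_drop]
        rintro (⟨rfl, _⟩ | h)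
        · omega
        · exact i1 h
      · by_cases ha : g + 2 ≤ a
        · exact Or.inr ⟨a, _, rfl, ha⟩
        · refine Or.inl (cov_new ?_)
          rw [abs_le]; omega

/-- The words of length `w.length + j` extending `w` with base `b`. -/
def Ext (b j : ℕ) (w u : List ℤ) : Prop :=
  Valid u ∧ w <:+ u ∧ u.length = w.length + j ∧ Base b (build u)

lemma ext_blocked {b j : ℕ} {g m : ℤ} {w u : List ℤ} (h : Ext b j (m :: w) u)
    (h0 : (g, 0) ∉ build (m :: w)) (hc : Cov (build (m :: w)) g ∨ g + 2 ≤ m)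
    (hg : ∃ i : ℕ, i < b ∧ g = 2 * (i : ℤ)) : False := by
  obtain ⟨h1, ⟨v, rfl⟩, _, h3⟩ := h
  exact (blocked h0 hc v h1).1 ((h3 g).2 hg)

lemma ext_succ {b j : ℕ} {w u : List ℤ} (h : Ext b (j + 1) w u) :
    ∃ x, Ext b j (x :: w) u := by
  obtain ⟨h1, ⟨v, rfl⟩, h2, h3⟩ := h
  have hv : v ≠ [] := by
    rintro rfl
    simp at h2
  obtain ⟨v', x, rfl⟩ := List.eq_nil_or_concat v |>.resolve_left hv
  refine ⟨x, h1, ⟨v', by simp⟩, ?_, h3⟩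
  simp at h2 ⊢
  omega

lemma ext_of_cons {b j : ℕ} {x : ℤ} {w u : List ℤ} (h : Ext b j (x :: w) u) :
    Ext b (j + 1) w u := by
  obtain ⟨h1, h4, h2, h3⟩ := h
  refine ⟨h1, (List.suffix_cons x w).trans h4, ?_, h3⟩
  simp at h2
  omega

lemma ext_ge {b j : ℕ} {x m : ℤ} {w u : List ℤ} (h : Ext b j (x :: m :: w) u) : m - 1 ≤ x := by
  obtain ⟨h1, ⟨v, rfl⟩, h2, h3⟩ := h
  exact (valid_append h1).1

lemma ext_unique {b j : ℕ} {x x' : ℤ} {w u : List ℤ} (h : Ext b j (x :: w) u)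
    (h' : Ext b j (x' :: w) u) : x = x' := by
  have := List.suffix_of_suffix_length_le h.2.1 h'.2.1 (by simp)
  have := this.eq_of_length (by simp)
  exact (List.cons.inj this).1

def F : ℕ → ℕ → ℕ → ℕ
  | 0, 0, _ => 1
  | 0, _ + 1, _ => 0
  | j + 1, 0, d => (∑ i ∈ Finset.range (d + 2), F j 0 i) + F j 0 0
  | j + 1, k + 1, d => (∑ i ∈ Finset.range (d + 2), F j (k + 1) i) + F j k 0

lemma F_closed (j : ℕ) : ∀ k d, F j k d = if k ≤ j then Nat.choose (2 * j + d + 1) (j - k) else 0 := by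
  induction j with
  | zero =>
    intro k d
    cases k <;> simp [F]
  | succ j ih =>
    have key : ∀ r N e : ℕ, (∑ i ∈ Finset.range e, Nat.choose (N + i) r) + Nat.choose N (r + 1)
        = Nat.choose (N + e) (r + 1) := by
      intro r N e
      induction e with
      | zero => simp
      | succ e ihe =>
        rw [Finset.sum_range_succ, ← add_assoc N e 1, Nat.choose_succ_succ']
        omega
    intro k d
    cases k with
    | zero =>
      simp only [F, ih]
      have h1 := key j (2 * j + 1) (d + 2)
      have h2 : Nat.choose (2 * j + 1) (j + 1) = Nat.choose (2 * j + 1) j :=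
        Nat.choose_symm_half j
      rw [h2] at h1
      simp only [Nat.zero_le, if_true, Nat.sub_zero, Nat.add_zero]
      rw [show 2 * (j + 1) + d + 1 = 2 * j + 1 + (d + 2) by ring, ← h1]
      congr 1
      exact Finset.sum_congr rfl fun i _ => by rw [show 2 * j + i + 1 = 2 * j + 1 + i by ring]
    | succ k =>
      simp only [F, ih]
      by_cases hk : k + 1 ≤ j
      · rw [if_pos (by omega : k ≤ j), if_pos (by omega : k + 1 ≤ j + 1)]
        simp only [hk, if_true]
        have h1 := key (j - (k + 1)) (2 * j + 1) (d + 2)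
        rw [show j - (k + 1) + 1 = j - k by omega] at h1
        rw [show 2 * (j + 1) + d + 1 = 2 * j + 1 + (d + 2) by ring,
          show j + 1 - (k + 1) = j - k by omega, ← h1]
        congr 1
        exact Finset.sum_congr rfl fun i _ => by rw [show 2 * j + i + 1 = 2 * j + 1 + i by ring]
      · simp only [hk, if_false, Finset.sum_const_zero, zero_add]
        by_cases hk2 : k ≤ j
        · obtain rfl : k = j := by omega
          simp
        · rw [if_neg hk2, if_neg (by omega)]

lemma main_count (b : ℕ) (j : ℕ) : ∀ (k d c : ℕ) (m M : ℤ) (w : List ℤ),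
    c + k = b → M = m + d → (k = 0 ∨ M = 2 * (c : ℤ) - 2) → Valid (m :: w) →
    Base c (build (m :: w)) →
    (∀ x y, (x, y) ∈ build (m :: w) → x ≤ M) →
    (∀ x, m - 1 ≤ x → x ≤ M + 1 → Cov (build (m :: w)) x) →
    ∃ A : Finset (List ℤ), (∀ u, u ∈ A ↔ Ext b j (m :: w) u) ∧ A.card = F j k d := by
  classical
  induction j with
  | zero =>
    intro k d c m M w hck hM hk hv hB hle hcov
    have hu : ∀ u, Ext b 0 (m :: w) u → u = m :: w := fun u h =>
      (h.2.1.eq_of_length (by rw [h.2.2.1]; rfl)).symm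
    cases k with
    | zero =>
      refine ⟨{m :: w}, fun u => ?_, by simp [F]⟩
      rw [Finset.mem_singleton]
      constructor
      · rintro rfl
        obtain rfl : c = b := by omega
        exact ⟨hv, List.suffix_rfl, rfl, hB⟩
      · exact hu u
    | succ k =>
      refine ⟨∅, fun u => ?_, by simp [F]⟩
      simp only [Finset.notMem_empty, false_iff]
      intro h
      obtain rfl := hu u h
      obtain ⟨i, h1, h2⟩ := (hB _).1 ((h.2.2.2 (2 * (c : ℤ))).2 ⟨c, by omega, rfl⟩)
      omega
  | succ j ih =>
    intro k d c m M w hck hM hk hv hB hle hcov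
    -- steps that stay weakly below `M`
    have hA : ∀ i : ℕ, i < d + 2 → ∃ A : Finset (List ℤ),
        (∀ u, u ∈ A ↔ Ext b j ((M - i) :: m :: w) u) ∧ A.card = F j k i := by
      intro i hi
      have hci : Cov (build (m :: w)) (M - i) := hcov _ (by omega) (by omega)
      refine ih k i c (M - i) M (m :: w) hck (by ring) hk ⟨by omega, hv⟩ ?_ ?_ ?_
      · intro x
        rw [build, base_drop_cov hci]
        exact hB x
      · intro x y hx
        rw [build, mem_drop] at hx
        rcases hx with ⟨rfl, _⟩ | hx
        · omega
        · exact hle x y hx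
      · intro x h1 h2
        rw [build]
        by_cases hx : x ≤ M - i + 1
        · exact cov_new (by rw [abs_le]; omega)
        · exact cov_mono (hcov x (by omega) h2)
    -- the one further step
    have hE : ∃ z : ℤ, M < z ∧ (∀ x u, M < x → Ext b j (x :: m :: w) u → x = z) ∧
        ∃ A : Finset (List ℤ), (∀ u, u ∈ A ↔ Ext b j (z :: m :: w) u) ∧
          A.card = F j (k - 1) 0 := by
      have hncov : ∀ x, M + 2 ≤ x → ¬ Cov (build (m :: w)) x := by
        rintro x hx ⟨x', y, h1, h2⟩
        have := hle x' y h1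
        rw [abs_le] at h2
        omega
      cases k with
      | zero =>
        obtain rfl : c = b := by omega
        have hci : Cov (build (m :: w)) (M + 1) := hcov _ (by omega) (by omega)
        refine ⟨M + 1, by omega, ?_, ?_⟩
        · intro x u hx hext
          by_contra hne
          have hnc := hncov x (by omega)
          obtain ⟨h1, ⟨v, rfl⟩, _, h3⟩ := hext
          have h4 : (x, 0) ∈ build (x :: m :: w) := by
            rw [build, base_drop_not_cov hnc]
            exact Or.inl rfl
          have h5 := (hB x).2 ((h3 x).1 (build_mono h4))
          have := hle _ _ h5
          omega
        · refine ih 0 0 c (M + 1) (M + 1) (m :: w) hck (by simp) (Or.inl rfl)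
            ⟨by omega, hv⟩ ?_ ?_ ?_
          · intro x
            rw [build, base_drop_cov hci]
            exact hB x
          · intro x y hx
            rw [build, mem_drop] at hx
            rcases hx with ⟨rfl, _⟩ | hx
            · omega
            · have := hle x y hx
              omega
          · intro x h1 h2
            rw [build]
            exact cov_new (by rw [abs_le]; omega)
      | succ k =>
        have hM2 : M = 2 * (c : ℤ) - 2 := by
          rcases hk with hk | hk
          · omega
          · exact hk
        have hnc := hncov (M + 2) (by omega)
        refine ⟨M + 2, by omega, ?_, ?_⟩
        · intro x u hx hext
          by_contra hne
          refine ext_blocked (g := M + 2) hext ?_ ?_ ⟨c, by omega, by omega⟩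
          · rw [build, mem_drop]
            rintro (⟨h, _⟩ | h)
            · exact hne h.symm
            · have := hle _ _ h
              omega
          · by_cases hx2 : M + 4 ≤ x
            · right; omega
            · left
              rw [build]
              exact cov_new (by rw [abs_le]; omega)
        · refine ih k 0 (c + 1) (M + 2) (M + 2) (m :: w) (by omega) (by simp)
            (Or.inr (by push_cast; omega)) ⟨by omega, hv⟩ ?_ ?_ ?_
          · intro x
            rw [build, base_drop_not_cov hnc, hB x]
            constructor
            · rintro (rfl | ⟨i, h1, h2⟩)
              · exact ⟨c, by omega, by omega⟩
              · exact ⟨i, by omega, h2⟩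
            · rintro ⟨i, h1, h2⟩
              by_cases hi : i = c
              · left; subst hi; omega
              · exact Or.inr ⟨i, by omega, h2⟩
          · intro x y hx
            rw [build, mem_drop] at hx
            rcases hx with ⟨rfl, _⟩ | hx
            · omega
            · have := hle x y hx
              omega
          · intro x h1 h2
            rw [build]
            exact cov_new (by rw [abs_le]; omega)
    choose! A hA1 hA2 using hA
    obtain ⟨z, hz, hzu, E, hE1, hE2⟩ := hE
    refine ⟨(Finset.range (d + 2)).biUnion A ∪ E, fun u => ?_, ?_⟩
    · rw [Finset.mem_union, Finset.mem_biUnion]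
      constructor
      · rintro (⟨i, hi, hu⟩ | hu)
        · exact ext_of_cons ((hA1 i (Finset.mem_range.1 hi) u).1 hu)
        · exact ext_of_cons ((hE1 u).1 hu)
      · intro h
        obtain ⟨x, hx⟩ := ext_succ h
        have hge := ext_ge hx
        by_cases hxM : M < x
        · right
          rw [hE1, ← hzu x u hxM hx]
          exact hx
        · left
          have e : M - ((M - x).toNat : ℤ) = x := by omega
          have hi : (M - x).toNat < d + 2 := by omega
          refine ⟨(M - x).toNat, Finset.mem_range.2 hi, ?_⟩
          rw [hA1 _ hi, e]
          exact hx
    · rw [Finset.card_union_of_disjoint, Finset.card_biUnion, hE2,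
        Finset.sum_congr rfl (fun i hi => hA2 i (Finset.mem_range.1 hi))]
      · cases k <;> simp [F]
      · intro i hi i' hi' hne
        refine Finset.disjoint_left.2 ?_
        intro u h1 h2
        rw [hA1 _ (by simpa using hi)] at h1
        rw [hA1 _ (by simpa using hi')] at h2
        have := ext_unique h1 h2
        omega
      · rw [Finset.disjoint_left]
        intro u h1 h2
        rw [Finset.mem_biUnion] at h1
        obtain ⟨i, hi, h1⟩ := h1
        rw [hA1 _ (Finset.mem_range.1 hi)] at h1
        rw [hE1] at h2
        have := ext_unique h1 h2
        omega

end DomTower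

open DomTower in
theorem domino_tower_count (n b : ℕ) (hb : 1 ≤ b) (hbn : b ≤ n) :
    Nat.card {T : Finset (ℤ × ℕ) // IsDominoTower n b T} = Nat.choose (2 * n - 1) (n - b) := by
  classical
  have hmem : ∀ a x : ℤ, ∀ y : ℕ, (x, y) ∈ build [a] ↔ x = a ∧ y = 0 := by
    intro a x y
    simp [build, drop, height]
  obtain ⟨A, hA, hcard⟩ := main_count b (n - 1) (b - 1) 0 1 0 0 [] (by omega) (by simp)
    (Or.inr (by simp)) trivial
    (by
      intro x
      rw [hmem]
      constructor
      · rintro ⟨rfl, _⟩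
        exact ⟨0, by omega, by simp⟩
      · rintro ⟨i, h1, h2⟩
        exact ⟨by omega, rfl⟩)
    (by
      intro x y hx
      rw [hmem] at hx
      omega)
    (by
      intro x h1 h2
      exact cov_new (by rw [abs_le]; omega))
  have himg : ∀ T, T ∈ A.image build ↔ IsDominoTower n b T := by
    intro T
    rw [Finset.mem_image]
    constructor
    · rintro ⟨u, hu, rfl⟩
      rw [hA] at hu
      obtain ⟨h1, h2, h3, h4⟩ := hu
      refine ⟨?_, h4, (heap_build u).1, (heap_build u).2⟩
      rw [card_build, h3]
      simp
      omega
    · rintro ⟨h1, h2, h3, h4⟩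
      obtain ⟨u, hv, rfl⟩ := build_surj n T h1 ⟨h3, h4⟩
      refine ⟨u, ?_, rfl⟩
      rw [hA]
      rw [card_build] at h1
      have hne : u ≠ [] := by
        rintro rfl
        simp at h1
        omega
      obtain ⟨v, a, rfl⟩ := List.eq_nil_or_concat u |>.resolve_left hne
      rw [List.concat_eq_append] at *
      have hext : Ext b (n - 1) [a] (v ++ [a]) := by
        refine ⟨hv, ⟨v, rfl⟩, ?_, h2⟩
        rw [h1]
        simp
        omega
      have h0 : a = 0 := by
        by_contra hne
        obtain ⟨i, hi, hai⟩ := (h2 a).1 (build_mono ((hmem a a 0).2 ⟨rfl, rfl⟩))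
        refine ext_blocked (g := 0) hext ?_ (Or.inr (by omega)) ⟨0, by omega, by simp⟩
        rw [hmem]
        rintro ⟨h, _⟩
        exact hne h.symm
      rw [h0] at hext ⊢
      exact hext
  have hc : (A.image build).card = A.card := by
    apply Finset.card_image_of_injOn
    intro u hu u' hu' he
    exact build_inj ((hA u).1 hu).1 ((hA u').1 hu').1 he
  rw [Nat.subtype_card (A.image build) himg, hc, hcard, F_closed, if_pos (by omega)]
  congr 1 <;> omega
end

section
/- For every integer n ≥ 1, the total number of domino towers built from n dominoes (i.e., the number of finite sets T that are an (n,b)-domino tower for some integer 1 ≤ b ≤ n) equals 4^(n−1). -/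
open PowerSeries in
/-- The series `u` with `u = X (1 + u)^2`. -/
noncomputable def dtU : PowerSeries ℚ :=
  X * (PowerSeries.map (Nat.castRingHom ℚ) catalanSeries) ^ 2

open PowerSeries in
lemma dtU_eq : dtU = X * (1 + dtU) ^ 2 := by
  have h := congrArg (PowerSeries.map (Nat.castRingHom ℚ)) catalanSeries_sq_mul_X_add_one
  simp only [map_add, map_mul, map_pow, map_X, map_one] at h
  have h2 : 1 + dtU = PowerSeries.map (Nat.castRingHom ℚ) catalanSeries := by
    rw [dtU]
    linear_combination h
  rw [h2, dtU]

lemma dtU_const : PowerSeries.constantCoeff dtU = 0 := by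
  simp [dtU]

/-- `v = 1 / (1 - u)`. -/
noncomputable def dtV : PowerSeries ℚ := (1 - dtU)⁻¹

lemma dtV_mul : dtV * (1 - dtU) = 1 := by
  rw [dtV, mul_comm]
  apply PowerSeries.mul_inv_cancel
  simp [dtU_const]

/-- The `u`-bracket `1 + u + ... + u^(k-1)`. -/
noncomputable def dtB (k : ℤ) : PowerSeries ℚ := ∑ i ∈ Finset.range k.toNat, dtU ^ i

lemma dtB_zero : dtB 0 = 0 := by simp [dtB]

lemma dtB_one : dtB 1 = 1 := by simp [dtB]

lemma dtB_mul (k : ℤ) : dtB k * (1 - dtU) = 1 - dtU ^ k.toNat :=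
  geom_sum_mul_neg dtU k.toNat

lemma dtB_succ (k : ℤ) (hk : 0 ≤ k) : dtB (k + 1) = 1 + dtU * dtB k := by
  have h : (k + 1).toNat = k.toNat + 1 := by omega
  rw [dtB, dtB, h, Finset.sum_range_succ', Finset.mul_sum, add_comm]
  simp [pow_succ']

lemma dtB_two : dtB 2 = 1 + dtU := by
  have := dtB_succ 1 (by norm_num)
  rw [dtB_one] at this
  norm_num at this
  exact this

lemma dtB_key (d e : ℤ) (hd : 0 ≤ d) (he : 1 ≤ e) :
    dtB (d + e) + dtU * dtB d * dtB (e - 1) = dtB (d + 1) * dtB e := by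
  have h1 := dtB_mul (d + e)
  have h2 := dtB_mul d
  have h3 := dtB_mul (e - 1)
  have h4 := dtB_mul (d + 1)
  have h5 := dtB_mul e
  obtain ⟨d, rfl⟩ := Int.eq_ofNat_of_zero_le hd
  obtain ⟨f, hf⟩ := Int.eq_ofNat_of_zero_le (show 0 ≤ e - 1 by omega)
  obtain rfl : e = f + 1 := by omega
  have t1 : ((d : ℤ) + (f + 1)).toNat = d + f + 1 := by omega
  have t2 : ((d : ℤ)).toNat = d := by omega
  have t3 : ((f : ℤ) + 1 - 1).toNat = f := by omega
  have t4 : ((d : ℤ) + 1).toNat = d + 1 := by omega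
  have t5 : ((f : ℤ) + 1).toNat = f + 1 := by omega
  rw [t1] at h1
  rw [t2] at h2
  rw [t3] at h3
  rw [t4] at h4
  rw [t5] at h5
  have hv := dtV_mul
  have e1 : ∀ a b : PowerSeries ℚ, a * (1 - dtU) = b → a = b * dtV := by
    intro a b h
    rw [← h, mul_assoc, mul_comm _ dtV, hv, mul_one]
  rw [e1 _ _ h1, e1 _ _ h2, e1 _ _ h3, e1 _ _ h4, e1 _ _ h5]
  have : ∀ w : PowerSeries ℚ, w * dtV = w * dtV * (dtV * (1 - dtU)) := by
    intro w; rw [hv, mul_one]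
  rw [this (1 - dtU ^ (d + f + 1))]
  ring

/-- Minimum of a finset of integers. -/
def dtMin (S : Finset ℤ) : ℤ := if h : S.Nonempty then S.min' h else 0

lemma dtMin_eq {S : Finset ℤ} {m : ℤ} (hm : m ∈ S) (h : ∀ b ∈ S, m ≤ b) : dtMin S = m := by
  rw [dtMin, dif_pos ⟨m, hm⟩]
  exact le_antisymm (Finset.min'_le _ _ hm) (h _ (Finset.min'_mem _ _))

lemma dtMin_mem {S : Finset ℤ} (h : S.Nonempty) : dtMin S ∈ S := by
  rw [dtMin, dif_pos h]; exact Finset.min'_mem _ _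

lemma dtMin_le {S : Finset ℤ} {b : ℤ} (h : b ∈ S) : dtMin S ≤ b := by
  rw [dtMin, dif_pos ⟨b, h⟩]; exact Finset.min'_le _ _ h

lemma dtMin_insert {S : Finset ℤ} {x : ℤ} (h : ∀ b ∈ S, x < b) : dtMin (insert x S) = x := by
  apply dtMin_eq (Finset.mem_insert_self _ _)
  intro b hb
  rcases Finset.mem_insert.1 hb with rfl | hb
  · exact le_rfl
  · exact (h b hb).le

/-- Product formula on sorted lists. -/
noncomputable def dtGL : List ℤ → PowerSeries ℚ
  | [] => 1
  | [_] => dtV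
  | a :: b :: l => dtB (b - a + 1) * dtGL (b :: l)

/-- Generating function of towers with base contained in `S`. -/
noncomputable def dtG (S : Finset ℤ) : PowerSeries ℚ := dtGL (S.sort (· ≤ ·))

lemma dtG_empty : dtG ∅ = 1 := by simp [dtG, dtGL]

lemma dtG_single (x : ℤ) : dtG {x} = dtV := by simp [dtG, dtGL]

lemma dt_sort_eq {S : Finset ℤ} (hS : S.Nonempty) :
    ∃ l, S.sort (· ≤ ·) = dtMin S :: l := by
  have h1 : S = insert (dtMin S) (S.erase (dtMin S)) := (Finset.insert_erase (dtMin_mem hS)).symm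
  refine ⟨(S.erase (dtMin S)).sort (· ≤ ·), ?_⟩
  conv_lhs => rw [h1]
  rw [Finset.sort_insert]
  · intro b hb
    exact dtMin_le (Finset.mem_of_mem_erase hb)
  · simp

lemma dtG_insert {S : Finset ℤ} (hS : S.Nonempty) {x : ℤ} (h : ∀ b ∈ S, x < b) :
    dtG (insert x S) = dtB (dtMin S - x + 1) * dtG S := by
  obtain ⟨l, hl⟩ := dt_sort_eq hS
  rw [dtG, Finset.sort_insert, dtG, hl, dtGL]
  · intro b hb; exact (h b hb).le
  · intro hx; exact lt_irrefl _ (h x hx)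

/-- Separated sets. -/
def dtSep (A : Finset ℤ) : Prop := ∀ x ∈ A, ∀ y ∈ A, x ≠ y → 2 ≤ |x - y|

/-- Positions touching `A`. -/
def dtN (A : Finset ℤ) : Finset ℤ := A.biUnion fun x => {x - 1, x, x + 1}

lemma mem_dtN {A : Finset ℤ} {z : ℤ} : z ∈ dtN A ↔ ∃ x ∈ A, |z - x| ≤ 1 := by
  simp only [dtN, Finset.mem_biUnion, Finset.mem_insert, Finset.mem_singleton]
  constructor
  · rintro ⟨x, hx, h⟩
    refine ⟨x, hx, ?_⟩
    rw [abs_le]; omega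
  · rintro ⟨x, hx, h⟩
    refine ⟨x, hx, ?_⟩
    rw [abs_le] at h; omega

lemma dtN_insert (A : Finset ℤ) (x : ℤ) :
    dtN (insert x A) = insert (x - 1) (insert x (insert (x + 1) (dtN A))) := by
  ext z
  simp only [dtN, Finset.mem_biUnion, Finset.mem_insert, Finset.mem_singleton]
  constructor
  · rintro ⟨y, rfl | hy, h⟩
    · tauto
    · right; right; right; exact ⟨y, hy, h⟩
  · rintro (h | h | h | ⟨y, hy, h⟩)
    · exact ⟨x, Or.inl rfl, by tauto⟩
    · exact ⟨x, Or.inl rfl, by tauto⟩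
    · exact ⟨x, Or.inl rfl, by tauto⟩
    · exact ⟨y, Or.inr hy, h⟩

lemma dtN_min {A : Finset ℤ} (hA : A.Nonempty) : dtMin (dtN A) = dtMin A - 1 := by
  apply dtMin_eq
  · rw [mem_dtN]; exact ⟨_, dtMin_mem hA, by simp⟩
  · intro b hb
    obtain ⟨x, hx, h⟩ := mem_dtN.1 hb
    have := dtMin_le hx
    rw [abs_le] at h; omega

open Classical in
/-- Generating function of towers with base exactly `A`. -/
noncomputable def dtH (A : Finset ℤ) : PowerSeries ℚ :=
  if dtSep A then PowerSeries.X ^ A.card * dtG (dtN A) else 0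

/-- Auxiliary weight. -/
noncomputable def dtK (A : Finset ℤ) (x : ℤ) : PowerSeries ℚ :=
  if A.Nonempty then dtH A * dtB (dtMin A - x - 1) else dtV

lemma dtSep_insert {A : Finset ℤ} (hA : A.Nonempty) {x : ℤ} (h : ∀ b ∈ A, x < b) :
    dtSep (insert x A) ↔ dtSep A ∧ 2 ≤ dtMin A - x := by
  constructor
  · intro hs
    refine ⟨fun y hy z hz => hs y (by simp [hy]) z (by simp [hz]), ?_⟩
    have hm := dtMin_mem hA
    have h1 := h _ hm
    have := hs (dtMin A) (by simp [hm]) x (by simp) (by omega)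
    rwa [abs_of_pos (by omega)] at this
  · rintro ⟨hs, h2⟩ y hy z hz hyz
    rcases Finset.mem_insert.1 hy with hy1 | hy1 <;> rcases Finset.mem_insert.1 hz with hz1 | hz1
    · exact absurd (hy1.trans hz1.symm) hyz
    · have := dtMin_le hz1
      rw [le_abs]; omega
    · have := dtMin_le hy1
      rw [le_abs]; omega
    · exact hs y hy1 z hz1 hyz

lemma dtH_insert {A : Finset ℤ} {x : ℤ} (h : ∀ b ∈ A, x < b) :
    dtH (insert x A) = dtU * dtK A x := by
  have hu := dtU_eq
  have hxA : x ∉ A := fun hx => lt_irrefl _ (h x hx)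
  have base : dtG (insert x {x + 1}) = dtB 2 * dtV := by
    rw [dtG_insert (by simp) (by simp), dtG_single,
      dtMin_eq (m := x + 1) (by simp) (by simp)]
    congr 2; ring
  by_cases hA : A.Nonempty
  · rw [dtK, if_pos hA]
    by_cases hs : dtSep A ∧ 2 ≤ dtMin A - x
    · have hm : ∀ b ∈ dtN A, dtMin A - 1 ≤ b := by
        intro b hb; rw [← dtN_min hA]; exact dtMin_le hb
      have hne : (dtN A).Nonempty := ⟨dtMin A, mem_dtN.2 ⟨_, dtMin_mem hA, by simp⟩⟩
      rw [dtH, if_pos ((dtSep_insert hA h).2 hs), dtH, if_pos hs.1, Finset.card_insert_of_notMem hxA,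
        dtN_insert]
      -- the inserted point `x + 1`
      have key : dtG (insert (x + 1) (dtN A)) = dtB (dtMin A - x - 1) * dtG (dtN A) ∧
          dtMin (insert (x + 1) (dtN A)) = x + 1 := by
        by_cases he : dtMin A - x = 2
        · have hmem : x + 1 ∈ dtN A := by
            have h1 : x + 1 = dtMin (dtN A) := by rw [dtN_min hA]; omega
            rw [h1]; exact dtMin_mem hne
          rw [Finset.insert_eq_of_mem hmem, dtN_min hA]
          have h1 : dtMin A - x - 1 = 1 := by omega
          rw [h1, dtB_one, one_mul]
          exact ⟨rfl, by omega⟩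
        · have hlt : ∀ b ∈ dtN A, x + 1 < b := by
            intro b hb; have := hm b hb; omega
          rw [dtG_insert hne hlt, dtN_min hA, dtMin_insert hlt]
          refine ⟨?_, rfl⟩
          congr 2; ring
      have hlt1 : ∀ b ∈ insert (x + 1) (dtN A), x < b := by
        intro b hb
        rcases Finset.mem_insert.1 hb with rfl | hb
        · omega
        · have := hm b hb; omega
      have hlt2 : ∀ b ∈ insert x (insert (x + 1) (dtN A)), x - 1 < b := by
        intro b hb
        rcases Finset.mem_insert.1 hb with rfl | hb
        · omega
        · have := hlt1 b hb; omega
      rw [dtG_insert (by simp) hlt2, dtG_insert (by simp) hlt1, dtMin_insert hlt1, key.1, key.2]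
      have e1 : x - (x - 1) + 1 = 2 := by ring
      have e2 : x + 1 - x + 1 = 2 := by ring
      rw [e1, e2, dtB_two, pow_succ]
      conv_rhs => rw [hu]
      ring
    · rw [dtH, if_neg (fun hh => hs ((dtSep_insert hA h).1 hh))]
      by_cases h1 : dtSep A
      · have h2 : dtMin A - x - 1 = 0 := by
          have := h _ (dtMin_mem hA)
          have : ¬ (2 ≤ dtMin A - x) := fun h2 => hs ⟨h1, h2⟩
          omega
        rw [h2, dtB_zero]; simp
      · rw [dtH, if_neg h1]; simp
  · rw [dtK, if_neg hA]
    rw [Finset.not_nonempty_iff_eq_empty] at hA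
    subst hA
    have hs : dtSep (insert x ∅) := by
      intro a ha b hb hab
      simp at ha hb
      omega
    rw [dtH, if_pos hs, dtN_insert]
    have e0 : insert (x + 1) (dtN ∅) = {x + 1} := by simp [dtN]
    have hlt1 : ∀ b ∈ ({x + 1} : Finset ℤ), x < b := by simp
    have hlt2 : ∀ b ∈ insert x ({x + 1} : Finset ℤ), x - 1 < b := by
      intro b hb
      simp at hb
      omega
    rw [e0, dtG_insert (by simp) hlt2, dtMin_insert hlt1, base]
    have e1 : x - (x - 1) + 1 = 2 := by ring
    rw [e1, dtB_two]
    simp only [insert_empty_eq, Finset.card_singleton, pow_one]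
    conv_rhs => rw [hu]
    ring

lemma dtH_empty : dtH ∅ = 1 := by
  have hs : dtSep ∅ := by intro a ha; simp at ha
  rw [dtH, if_pos hs]
  simp [dtN, dtG_empty]

lemma dt_sum_insert (S : Finset ℤ) (y : ℤ) (h : ∀ b ∈ S, y < b) (f : Finset ℤ → PowerSeries ℚ) :
    ∑ A ∈ (insert y S).powerset, f A =
      ∑ A ∈ S.powerset, f A + ∑ A ∈ S.powerset, f (insert y A) :=
  Finset.sum_powerset_insert (fun hy => lt_irrefl _ (h y hy)) f

lemma dt_main (S : Finset ℤ) :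
    (S.Nonempty → ∀ x : ℤ, (∀ b ∈ S, x < b) →
      ∑ A ∈ S.powerset, dtK A x = dtG S * dtB (dtMin S - x)) ∧
    ∑ A ∈ S.powerset, dtH A = dtG S := by
  induction S using Finset.induction_on_min with
  | empty => simp [dtH_empty, dtG_empty]
  | insert y S hy ih =>
    have hsub : ∀ A ∈ S.powerset, ∀ b ∈ A, y < b := fun A hA b hb =>
      hy b (Finset.mem_powerset.1 hA hb)
    have hins : ∑ A ∈ S.powerset, dtH (insert y A) = dtU * ∑ A ∈ S.powerset, dtK A y := by
      rw [Finset.mul_sum]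
      exact Finset.sum_congr rfl fun A hA => dtH_insert (hsub A hA)
    have hK : ∀ x, ∑ A ∈ S.powerset, dtK (insert y A) x =
        (∑ A ∈ S.powerset, dtH (insert y A)) * dtB (y - x - 1) := by
      intro x
      rw [Finset.sum_mul]
      refine Finset.sum_congr rfl fun A hA => ?_
      rw [dtK, if_pos (by simp), dtMin_insert (hsub A hA)]
    by_cases hS : S.Nonempty
    · have ihy := ih.1 hS y hy
      have hd : y < dtMin S := hy _ (dtMin_mem hS)
      constructor
      · intro _ x hx
        have hxy : x < y := hx y (by simp)
        rw [dt_sum_insert S y hy, hK, hins, ihy, ih.1 hS x (fun b hb => hx b (by simp [hb])),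
          dtG_insert hS hy, dtMin_insert hy]
        have := dtB_key (dtMin S - y) (y - x) (by omega) (by omega)
        have e : dtMin S - y + (y - x) = dtMin S - x := by ring
        rw [e] at this
        linear_combination dtG S * this
      · rw [dt_sum_insert S y hy, hins, ihy, ih.2, dtG_insert hS hy, dtB_succ _ (by omega)]
        ring
    · rw [Finset.not_nonempty_iff_eq_empty] at hS
      subst hS
      have hk0 : ∀ x, dtK ∅ x = dtV := by intro x; simp [dtK]
      have hv := dtV_mul
      constructor
      · intro _ x hx
        have hxy : x < y := hx y (by simp)
        rw [dt_sum_insert ∅ y hy, hK, hins, dtMin_insert hy]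
        have := dtB_succ (y - x - 1) (by omega)
        rw [sub_add_cancel] at this
        simp only [Finset.powerset_empty, Finset.sum_singleton, hk0, insert_empty_eq, dtG_single]
        rw [this]; ring
      · rw [dt_sum_insert ∅ y hy, hins]
        simp only [Finset.powerset_empty, Finset.sum_singleton, hk0, insert_empty_eq, dtG_single,
          dtH_empty]
        linear_combination -hv

/-- Towers with a given base `A`. -/
def dtT (n : ℕ) (A : Finset ℤ) (T : Finset (ℤ × ℕ)) : Prop :=
  T.card = n ∧
  (∀ x : ℤ, (x, 0) ∈ T ↔ x ∈ A) ∧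
  (∀ x x' : ℤ, ∀ y : ℕ, (x, y) ∈ T → (x', y) ∈ T → x ≠ x' → 2 ≤ |x - x'|) ∧
  (∀ x : ℤ, ∀ y : ℕ, (x, y + 1) ∈ T → ∃ x' : ℤ, (x', y) ∈ T ∧ |x - x'| ≤ 1)

/-- Put `T` one level up on top of `A`. -/
def dtBuild (A : Finset ℤ) (T : Finset (ℤ × ℕ)) : Finset (ℤ × ℕ) :=
  A.image (fun x => (x, 0)) ∪ T.image (fun p => (p.1, p.2 + 1))

lemma mem_dtBuild_zero {A : Finset ℤ} {T : Finset (ℤ × ℕ)} {x : ℤ} :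
    (x, 0) ∈ dtBuild A T ↔ x ∈ A := by
  simp [dtBuild]

lemma mem_dtBuild_succ {A : Finset ℤ} {T : Finset (ℤ × ℕ)} {x : ℤ} {y : ℕ} :
    (x, y + 1) ∈ dtBuild A T ↔ (x, y) ∈ T := by
  simp [dtBuild]

lemma dtBuild_injective (A : Finset ℤ) : Function.Injective (dtBuild A) := by
  intro T T' h
  ext ⟨x, y⟩
  rw [← mem_dtBuild_succ (A := A), h, mem_dtBuild_succ]

lemma dtBuild_card (A : Finset ℤ) (T : Finset (ℤ × ℕ)) :
    (dtBuild A T).card = A.card + T.card := by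
  rw [dtBuild, Finset.card_union_of_disjoint, Finset.card_image_of_injective,
    Finset.card_image_of_injective]
  · rintro ⟨a, b⟩ ⟨c, d⟩ h
    simpa using h
  · intro a b h
    simpa using h
  · rw [Finset.disjoint_left]
    rintro ⟨a, b⟩ h1 h2
    simp at h1 h2
    omega

lemma dtT_iff {n : ℕ} {A : Finset ℤ} (T : Finset (ℤ × ℕ)) (hs : dtSep A) (hn : A.card ≤ n) :
    dtT n A T ↔ ∃ T', (∃ B ⊆ dtN A, dtT (n - A.card) B T') ∧ dtBuild A T' = T := by
  constructor
  · rintro ⟨h1, h2, h3, h4⟩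
    let T' : Finset (ℤ × ℕ) := (T.filter (fun p => 0 < p.2)).image (fun p => (p.1, p.2 - 1))
    have hT' : ∀ x y, (x, y) ∈ T' ↔ (x, y + 1) ∈ T := by
      intro x y
      simp only [T', Finset.mem_image, Finset.mem_filter, Prod.exists, Prod.mk.injEq]
      constructor
      · rintro ⟨a, b, ⟨hab, hb⟩, rfl, rfl⟩
        have : b - 1 + 1 = b := Nat.sub_add_cancel hb
        rwa [this]
      · intro h
        exact ⟨x, y + 1, ⟨h, by simp⟩, rfl, rfl⟩
    have hb : dtBuild A T' = T := by
      ext ⟨x, y⟩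
      cases y with
      | zero => rw [mem_dtBuild_zero, h2]
      | succ y => rw [mem_dtBuild_succ, hT']
    refine ⟨T', ⟨(T'.filter (fun p => p.2 = 0)).image Prod.fst, ?_, ?_, ?_, ?_, ?_⟩, hb⟩
    · intro x hx
      simp only [Finset.mem_image, Finset.mem_filter, Prod.exists] at hx
      obtain ⟨a, b, ⟨hab, rfl⟩, rfl⟩ := hx
      obtain ⟨x', hx', hxx⟩ := h4 a 0 ((hT' _ _).1 hab)
      exact mem_dtN.2 ⟨x', (h2 _).1 hx', hxx⟩
    · have := dtBuild_card A T'
      rw [hb] at this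
      omega
    · intro x
      simp
    · intro x x' y hx hx'
      exact h3 x x' (y + 1) ((hT' _ _).1 hx) ((hT' _ _).1 hx')
    · intro x y hx
      obtain ⟨x', hx', h⟩ := h4 x (y + 1) ((hT' _ _).1 hx)
      exact ⟨x', (hT' _ _).2 hx', h⟩
  · rintro ⟨T', ⟨B, hB, h1, h2, h3, h4⟩, rfl⟩
    refine ⟨?_, fun x => mem_dtBuild_zero, ?_, ?_⟩
    · rw [dtBuild_card, h1]; omega
    · intro x x' y hx hx' hne
      cases y with
      | zero => exact hs x (mem_dtBuild_zero.1 hx) x' (mem_dtBuild_zero.1 hx') hne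
      | succ y => exact h3 x x' y (mem_dtBuild_succ.1 hx) (mem_dtBuild_succ.1 hx') hne
    · intro x y hx
      rw [mem_dtBuild_succ] at hx
      cases y with
      | zero =>
        obtain ⟨x', hx', h⟩ := mem_dtN.1 (hB ((h2 x).1 hx))
        exact ⟨x', mem_dtBuild_zero.2 hx', h⟩
      | succ y =>
        obtain ⟨x', hx', h⟩ := h4 x y hx
        exact ⟨x', mem_dtBuild_succ.2 hx', h⟩

lemma dtT_empty {n : ℕ} {T : Finset (ℤ × ℕ)} : dtT n ∅ T ↔ n = 0 ∧ T = ∅ := by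
  constructor
  · rintro ⟨h1, h2, h3, h4⟩
    have : ∀ y x, (x, y) ∉ T := by
      intro y
      induction y with
      | zero => intro x hx; simpa using (h2 x).1 hx
      | succ y ih =>
        intro x hx
        obtain ⟨x', hx', _⟩ := h4 x y hx
        exact ih x' hx'
    have hT : T = ∅ := by
      ext ⟨x, y⟩
      simp [this y x]
    subst hT
    exact ⟨by simpa using h1.symm, rfl⟩
  · rintro ⟨rfl, rfl⟩
    refine ⟨?_, ?_, ?_, ?_⟩ <;> simp

lemma dt_count (n : ℕ) : ∀ A : Finset ℤ, ∃ F : Finset (Finset (ℤ × ℕ)),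
    (∀ T, T ∈ F ↔ dtT n A T) ∧ (F.card : ℚ) = PowerSeries.coeff n (dtH A) := by
  induction n using Nat.strong_induction_on with
  | _ n ih =>
  intro A
  by_cases hA : A = ∅
  · subst hA
    rw [dtH_empty, PowerSeries.coeff_one]
    by_cases hn : n = 0
    · refine ⟨{∅}, fun T => ?_, by simp [hn]⟩
      rw [dtT_empty]; simp [hn]
    · refine ⟨∅, fun T => ?_, by simp [hn]⟩
      rw [dtT_empty]; simp [hn]
  have hpos : 0 < A.card := Finset.card_pos.2 (Finset.nonempty_iff_ne_empty.2 hA)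
  by_cases hs : dtSep A
  swap
  · refine ⟨∅, fun T => ?_, by simp [dtH, hs]⟩
    simp only [Finset.notMem_empty, false_iff]
    rintro ⟨h1, h2, h3, h4⟩
    exact hs fun x hx y hy => h3 x y 0 ((h2 x).2 hx) ((h2 y).2 hy)
  have hH : dtH A = PowerSeries.X ^ A.card * dtG (dtN A) := by rw [dtH, if_pos hs]
  by_cases hn : A.card ≤ n
  swap
  · refine ⟨∅, fun T => ?_, ?_⟩
    · simp only [Finset.notMem_empty, false_iff]
      rintro ⟨h1, h2, h3, h4⟩
      apply hn
      rw [← h1, ← Finset.card_image_of_injective A (f := fun x : ℤ => (x, (0 : ℕ)))]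
      · apply Finset.card_le_card
        intro p hp
        obtain ⟨x, hx, rfl⟩ := Finset.mem_image.1 hp
        exact (h2 x).2 hx
      · intro a b h
        simpa using h
    · rw [hH, PowerSeries.coeff_X_pow_mul', if_neg hn]; simp
  choose F hF hc using ih (n - A.card) (by omega)
  refine ⟨((dtN A).powerset.biUnion F).image (dtBuild A), fun T => ?_, ?_⟩
  · rw [dtT_iff T hs hn]
    simp only [Finset.mem_image, Finset.mem_biUnion, Finset.mem_powerset, hF]
  · rw [Finset.card_image_of_injective _ (dtBuild_injective A), Finset.card_biUnion, hH,
      PowerSeries.coeff_X_pow_mul', if_pos hn, ← (dt_main (dtN A)).2]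
    · push_cast
      rw [map_sum]
      exact Finset.sum_congr rfl fun B _ => hc B
    · intro B _ B' _ hne
      rw [Function.onFun, Finset.disjoint_left]
      intro T h1 h2
      apply hne
      ext x
      rw [← ((hF _ _).1 h1).2.1 x, ← ((hF _ _).1 h2).2.1 x]

/-- Convex base starting at `c`. -/
def dtBase (b : ℕ) (c : ℤ) : Finset ℤ := (Finset.range b).image (fun i : ℕ => c + 2 * (i : ℤ))

lemma dtBase_succ (b : ℕ) (c : ℤ) : dtBase (b + 1) c = insert c (dtBase b (c + 2)) := by
  ext x
  simp only [dtBase, Finset.mem_image, Finset.mem_range, Finset.mem_insert]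
  constructor
  · rintro ⟨i, hi, rfl⟩
    cases i with
    | zero => left; simp
    | succ i => right; exact ⟨i, by omega, by push_cast; ring⟩
  · rintro (rfl | ⟨i, hi, rfl⟩)
    · exact ⟨0, by omega, by simp⟩
    · exact ⟨i + 1, by omega, by push_cast; ring⟩

lemma dtH_base (b : ℕ) : ∀ c : ℤ, dtH (dtBase (b + 1) c) = dtU ^ (b + 1) * dtV := by
  have hlt : ∀ b c, ∀ x ∈ dtBase b (c + 2), c < x := by
    intro b c x hx
    simp only [dtBase, Finset.mem_image] at hx
    obtain ⟨i, _, rfl⟩ := hx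
    omega
  induction b with
  | zero =>
    intro c
    rw [dtBase_succ, dtH_insert (hlt 0 c)]
    simp [dtBase, dtK]
  | succ b ih =>
    intro c
    have hm : dtMin (dtBase (b + 1) (c + 2)) = c + 2 := by
      rw [dtBase_succ]
      exact dtMin_insert (hlt b (c + 2))
    rw [dtBase_succ, dtH_insert (hlt _ c), dtK, if_pos (by rw [dtBase_succ]; simp), ih, hm]
    have : c + 2 - c - 1 = 1 := by ring
    rw [this, dtB_one]
    ring

lemma dt_coeff (n : ℕ) (hn : 1 ≤ n) :
    ∑ b ∈ Finset.range n, PowerSeries.coeff n (dtU ^ (b + 1) * dtV) = (4 : ℚ) ^ (n - 1) := by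
  have hv := dtV_mul
  have hu := dtU_eq
  have h1 : ∑ b ∈ Finset.range n, dtU ^ (b + 1) * dtV =
      dtU * dtV ^ 2 - dtU ^ (n + 1) * dtV ^ 2 := by
    have hg := geom_sum_mul_neg dtU n
    have : ∑ b ∈ Finset.range n, dtU ^ (b + 1) * dtV =
        (∑ b ∈ Finset.range n, dtU ^ b) * dtU * dtV := by
      rw [Finset.sum_mul, Finset.sum_mul]
      exact Finset.sum_congr rfl fun b _ => by ring
    rw [this]
    linear_combination dtU * dtV ^ 2 * hg - (∑ b ∈ Finset.range n, dtU ^ b) * dtU * dtV * hv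
  have h2 : dtU * dtV ^ 2 * (1 - 4 * PowerSeries.X) = PowerSeries.X := by
    linear_combination (dtV ^ 2) * hu + PowerSeries.X * (dtV * (1 - dtU) + 1) * hv
  have h3 : dtU * dtV ^ 2 = PowerSeries.X * PowerSeries.mk (fun k => (4 : ℚ) ^ k) := by
    have h4 : PowerSeries.mk (fun k => (4 : ℚ) ^ k) * (1 - 4 * PowerSeries.X) = 1 := by
      have h5 : (4 : PowerSeries ℚ) = PowerSeries.C (4 : ℚ) := (map_ofNat PowerSeries.C 4).symm
      rw [h5]
      ext k
      rw [mul_sub, mul_one, map_sub, ← mul_assoc]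
      cases k with
      | zero => simp
      | succ k =>
        rw [PowerSeries.coeff_succ_mul_X, PowerSeries.coeff_mul_C]
        simp [PowerSeries.coeff_one, pow_succ]
    linear_combination (PowerSeries.mk (fun k => (4 : ℚ) ^ k)) * h2 - dtU * dtV ^ 2 * h4
  have h6 : PowerSeries.coeff n (dtU ^ (n + 1) * dtV ^ 2) = 0 := by
    rw [hu, mul_pow, mul_assoc, PowerSeries.coeff_X_pow_mul', if_neg (by omega)]
  rw [← map_sum, h1, map_sub, h6, h3, sub_zero]
  obtain ⟨m, rfl⟩ : ∃ m, n = m + 1 := ⟨n - 1, by omega⟩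
  rw [PowerSeries.coeff_succ_X_mul]
  simp

lemma isDominoTower_iff (n b : ℕ) (T : Finset (ℤ × ℕ)) :
    IsDominoTower n b T ↔ dtT n (dtBase b 0) T := by
  have : ∀ x : ℤ, (∃ i : ℕ, i < b ∧ x = 2 * (i : ℤ)) ↔ x ∈ dtBase b 0 := by
    intro x
    simp only [dtBase, Finset.mem_image, Finset.mem_range, zero_add]
    exact exists_congr fun i => and_congr_right fun _ => eq_comm
  simp only [IsDominoTower, dtT, this]

theorem total_domino_tower_count (n : ℕ) (hn : 1 ≤ n) :
    Nat.card {T : Finset (ℤ × ℕ) // ∃ b : ℕ, 1 ≤ b ∧ b ≤ n ∧ IsDominoTower n b T} =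
      4 ^ (n - 1) := by
  choose F hF hc using dt_count n
  have hmem : ∀ T : Finset (ℤ × ℕ), (∃ b : ℕ, 1 ≤ b ∧ b ≤ n ∧ IsDominoTower n b T) ↔
      T ∈ (Finset.range n).biUnion (fun b => F (dtBase (b + 1) 0)) := by
    intro T
    simp only [Finset.mem_biUnion, Finset.mem_range, hF, isDominoTower_iff]
    constructor
    · rintro ⟨b, h1, h2, h⟩
      refine ⟨b - 1, by omega, ?_⟩
      rwa [Nat.sub_add_cancel h1]
    · rintro ⟨b, h1, h⟩
      exact ⟨b + 1, by omega, by omega, h⟩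
  have hcard : ∀ b c, (dtBase b c).card = b := by
    intro b c
    rw [dtBase, Finset.card_image_of_injective, Finset.card_range]
    intro i j hij
    simpa using hij
  rw [Nat.card_congr (Equiv.subtypeEquivRight hmem), Nat.card_eq_fintype_card, Fintype.card_coe,
    Finset.card_biUnion]
  · have := dt_coeff n hn
    simp only [← dtH_base _ 0, ← hc] at this
    exact_mod_cast this
  · intro b _ b' _ hne
    rw [Function.onFun, Finset.disjoint_left]
    intro T h1 h2
    apply hne
    have : dtBase (b + 1) 0 = dtBase (b' + 1) 0 := by
      ext x
      rw [← ((hF _ _).1 h1).2.1 x, ← ((hF _ _).1 h2).2.1 x]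
    have h3 := congrArg Finset.card this
    rw [hcard, hcard] at h3
    omega
end

section
/- For all integers n ≥ 2 and b ≥ 2, the number of (n,b)-domino towers equals the number of (n−1,b−1)-domino towers, plus twice the number of (n−1,b)-domino towers, plus the number of (n−1,b+1)-domino towers (where the number of (m,c)-domino towers is 0 whenever c > m). -/
namespace DT

/-- neighbourhood of a position -/
noncomputable def nb (x : ℤ) : Finset ℤ := Finset.Icc (x - 1) (x + 1)

/-- neighbourhood of a set of positions -/
noncomputable def N (S : Finset ℤ) : Finset ℤ := S.biUnion nb

/-- admissible (non-overlapping) rows -/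
def Adm (S : Finset ℤ) : Prop := ∀ a ∈ S, ∀ b ∈ S, a ≠ b → 2 ≤ |a - b|

open Classical in
/-- admissible rows inside `M` -/
noncomputable def adm (M : Finset ℤ) : Finset (Finset ℤ) := M.powerset.filter Adm

/-- the local rules of a tower -/
def Ok (T : Finset (ℤ × ℕ)) : Prop :=
  (∀ x x' : ℤ, ∀ y : ℕ, (x, y) ∈ T → (x', y) ∈ T → x ≠ x' → 2 ≤ |x - x'|) ∧
  (∀ x : ℤ, ∀ y : ℕ, (x, y + 1) ∈ T → ∃ x' : ℤ, (x', y) ∈ T ∧ |x - x'| ≤ 1)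

/-- towers with base contained in `M` -/
def Q (M : Finset ℤ) (n : ℤ) : Type :=
  {T : Finset (ℤ × ℕ) // (T.card : ℤ) = n ∧ (∀ x, (x, 0) ∈ T → x ∈ M) ∧ Ok T}

/-- towers with base equal to `S` -/
def B (S : Finset ℤ) (n : ℤ) : Type :=
  {T : Finset (ℤ × ℕ) // (T.card : ℤ) = n ∧ (∀ x, (x, 0) ∈ T ↔ x ∈ S) ∧ Ok T}

noncomputable def G (M : Finset ℤ) (n : ℤ) : ℕ := Nat.card (Q M n)

def up : ℤ × ℕ ↪ ℤ × ℕ := ⟨fun p => (p.1, p.2 + 1), by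
  rintro ⟨a, b⟩ ⟨c, d⟩ h; simpa using h⟩

def ground : ℤ ↪ ℤ × ℕ := ⟨fun x => (x, 0), by intro a b h; simpa using h⟩

@[simp] lemma up_apply (p : ℤ × ℕ) : up p = (p.1, p.2 + 1) := rfl

@[simp] lemma ground_apply (x : ℤ) : ground x = (x, 0) := rfl

noncomputable def down (T : Finset (ℤ × ℕ)) : Finset (ℤ × ℕ) :=
  T.preimage up up.injective.injOn

def build (S : Finset ℤ) (U : Finset (ℤ × ℕ)) : Finset (ℤ × ℕ) := U.map up ∪ S.map ground

lemma mem_down (T : Finset (ℤ × ℕ)) (x : ℤ) (y : ℕ) : (x, y) ∈ down T ↔ (x, y + 1) ∈ T := by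
  simp [down]

lemma mem_build_zero (S U) (x : ℤ) : (x, 0) ∈ build S U ↔ x ∈ S := by
  simp [build]

lemma mem_build_succ (S U) (x : ℤ) (y : ℕ) : (x, y + 1) ∈ build S U ↔ (x, y) ∈ U := by
  simp [build]

lemma card_build (S U) : (build S U).card = U.card + S.card := by
  unfold build
  rw [Finset.card_union_of_disjoint, Finset.card_map, Finset.card_map]
  rw [Finset.disjoint_left]
  simp
  intros
  omega

lemma down_build (S U) : down (build S U) = U := by
  ext ⟨x, y⟩; rw [mem_down, mem_build_succ]

lemma build_down (S T) (h : ∀ x, (x, 0) ∈ T ↔ x ∈ S) : build S (down T) = T := by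
  ext ⟨x, y⟩
  cases y with
  | zero => rw [mem_build_zero, h]
  | succ y => rw [mem_build_succ, mem_down]

lemma mem_nb (x y : ℤ) : x ∈ nb y ↔ |x - y| ≤ 1 := by
  simp only [nb, Finset.mem_Icc, abs_le]; omega

lemma mem_N (x : ℤ) (S) : x ∈ N S ↔ ∃ y ∈ S, |x - y| ≤ 1 := by
  simp [N, mem_nb]

lemma ok_build (S U) (hS : Adm S) (hU : Ok U) (h : ∀ x, (x, 0) ∈ U → x ∈ N S) :
    Ok (build S U) := by
  constructor
  · intro x x' y h1 h2
    cases y with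
    | zero => rw [mem_build_zero] at h1 h2; exact hS _ h1 _ h2
    | succ y => rw [mem_build_succ] at h1 h2; exact hU.1 _ _ _ h1 h2
  · intro x y h1
    rw [mem_build_succ] at h1
    cases y with
    | zero =>
      obtain ⟨z, hz, hz'⟩ := (mem_N _ _).1 (h x h1)
      exact ⟨z, (mem_build_zero _ _ _).2 hz, hz'⟩
    | succ y =>
      obtain ⟨z, hz, hz'⟩ := hU.2 _ _ h1
      exact ⟨z, (mem_build_succ _ _ _ _).2 hz, hz'⟩

lemma ok_down (T) (h : Ok T) : Ok (down T) := by
  constructor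
  · intro x x' y h1 h2
    rw [mem_down] at h1 h2; exact h.1 _ _ _ h1 h2
  · intro x y h1
    rw [mem_down] at h1
    obtain ⟨z, hz, hz'⟩ := h.2 _ _ h1
    exact ⟨z, (mem_down _ _ _).2 hz, hz'⟩

noncomputable def equivB (S : Finset ℤ) (hS : Adm S) (n : ℤ) : B S n ≃ Q (N S) (n - S.card) where
  toFun T := ⟨down T.1, by
    have h1 := card_build S (down T.1)
    rw [build_down S T.1 T.2.2.1] at h1
    have h2 := T.2.1
    omega, by
    intro x hx
    rw [mem_down] at hx
    obtain ⟨z, hz, hz'⟩ := T.2.2.2.2 _ _ hx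
    exact (mem_N _ _).2 ⟨z, (T.2.2.1 z).1 hz, hz'⟩, ok_down _ T.2.2.2⟩
  invFun U := ⟨build S U.1, by
    have h1 := card_build S U.1
    have h2 := U.2.1
    omega, mem_build_zero S U.1, ok_build S U.1 hS U.2.2.2 U.2.2.1⟩
  left_inv T := Subtype.ext (build_down S T.1 T.2.2.1)
  right_inv U := Subtype.ext (down_build S U.1)

/-- the base row of a tower -/
noncomputable def base (T : Finset (ℤ × ℕ)) : Finset ℤ := T.preimage ground ground.injective.injOn

lemma mem_base (T) (x : ℤ) : x ∈ base T ↔ (x, 0) ∈ T := by simp [base]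

lemma mem_adm (M S) : S ∈ adm M ↔ S ⊆ M ∧ Adm S := by simp [adm]

noncomputable def equivQ (M : Finset ℤ) (n : ℤ) : Q M n ≃ Σ S : adm M, B S.1 n where
  toFun T := ⟨⟨base T.1, (mem_adm _ _).2 ⟨fun x hx => T.2.2.1 x ((mem_base _ _).1 hx),
    fun a ha b hb => T.2.2.2.1 a b 0 ((mem_base _ _).1 ha) ((mem_base _ _).1 hb)⟩⟩,
    ⟨T.1, T.2.1, fun x => (mem_base _ _).symm, T.2.2.2⟩⟩
  invFun p := ⟨p.2.1, p.2.2.1, fun x hx => ((mem_adm _ _).1 p.1.2).1 ((p.2.2.2.1 x).1 hx),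
    p.2.2.2.2⟩
  left_inv T := rfl
  right_inv := by
    rintro ⟨⟨S, hS⟩, ⟨T, hT⟩⟩
    have : S = base T := by ext x; rw [mem_base, hT.2.1]
    subst this
    rfl

lemma empty_of_base (T : Finset (ℤ × ℕ)) (hT : Ok T) (h : ∀ x, (x, 0) ∉ T) : T = ∅ := by
  have : ∀ y : ℕ, ∀ x : ℤ, (x, y) ∉ T := by
    intro y
    induction y with
    | zero => exact h
    | succ y ih =>
      intro x hx
      obtain ⟨z, hz, _⟩ := hT.2 _ _ hx
      exact ih z hz
  ext ⟨x, y⟩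
  simp [this y x]

lemma Q_neg (M) (n : ℤ) (hn : n < 0) : IsEmpty (Q M n) :=
  ⟨fun T => by have := T.2.1; omega⟩

lemma finQ (k : ℕ) : ∀ (n : ℤ) (M : Finset ℤ), n < k → Finite (Q M n) := by
  induction k with
  | zero => intro n M hn; have := Q_neg M n (by simpa using hn); infer_instance
  | succ k ih =>
    intro n M hn
    have : ∀ S : adm M, Finite (B S.1 n) := by
      intro S
      have hS := ((mem_adm _ _).1 S.2).2
      by_cases h : S.1 = ∅
      · have : Subsingleton (B S.1 n) := by
          constructor
          intro a b
          apply Subtype.ext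
          rw [empty_of_base a.1 a.2.2.2 (fun x hx => by have := (a.2.2.1 x).1 hx; simp [h] at this),
            empty_of_base b.1 b.2.2.2 (fun x hx => by have := (b.2.2.1 x).1 hx; simp [h] at this)]
        infer_instance
      · have hc : 0 < S.1.card := Finset.card_pos.2 (Finset.nonempty_iff_ne_empty.2 h)
        have := ih (n - S.1.card) (N S.1) (by push_cast at hn; omega)
        exact Finite.of_equiv _ (equivB S.1 hS n).symm
    exact Finite.of_equiv _ (equivQ M n).symm

instance (M n) : Finite (Q M n) := finQ (n.toNat + 1) n M (by omega)

lemma G_sum (M : Finset ℤ) (n : ℤ) : G M n = ∑ S ∈ adm M, G (N S) (n - S.card) := by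
  have e : Q M n ≃ Σ S : adm M, Q (N S.1) (n - S.1.card) :=
    (equivQ M n).trans (Equiv.sigmaCongrRight fun S => equivB S.1 ((mem_adm _ _).1 S.2).2 n)
  unfold G
  rw [Nat.card_congr e, Nat.card_sigma]
  exact Finset.sum_coe_sort (adm M) (fun S => Nat.card (Q (N S) (n - S.card)))

lemma G_neg (M) (n : ℤ) (hn : n < 0) : G M n = 0 := by
  have := Q_neg M n hn
  simp [G]

lemma mem_self_nb (x : ℤ) : x ∈ nb x := by simp [mem_nb]

lemma N_insert (x : ℤ) (S) : N (insert x S) = N S ∪ nb x := by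
  simp [N, Finset.union_comm]

lemma sum_adm (A : Finset ℤ) (y : ℤ) (hy : y ∈ A) (f : Finset ℤ → ℕ) :
    ∑ S ∈ adm A, f S = ∑ S ∈ adm (A.erase y), f S + ∑ S ∈ adm (A \ nb y), f (insert y S) := by
  classical
  rw [← Finset.sum_filter_not_add_sum_filter (adm A) (fun S => y ∈ S)]
  congr 1
  · apply Finset.sum_congr _ (fun _ _ => rfl)
    ext S
    simp only [Finset.mem_filter, mem_adm, Finset.subset_erase]
    tauto
  · symm
    apply Finset.sum_bij (fun S _ => insert y S)
    · intro S hS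
      obtain ⟨h1, h2⟩ := (mem_adm _ _).1 hS
      have h3 : ∀ a ∈ S, 2 ≤ |a - y| := by
        intro a ha
        have := (Finset.mem_sdiff.1 (h1 ha)).2
        rw [mem_nb] at this; omega
      simp only [Finset.mem_filter, mem_adm, Finset.mem_insert_self, and_true]
      refine ⟨Finset.insert_subset hy (h1.trans Finset.sdiff_subset), ?_⟩
      intro a ha b hb hab
      rcases Finset.mem_insert.1 ha with ha1 | ha1 <;> rcases Finset.mem_insert.1 hb with hb1 | hb1
      · exact absurd (ha1.trans hb1.symm) hab
      · rw [ha1, abs_sub_comm]; exact h3 _ hb1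
      · rw [hb1]; exact h3 _ ha1
      · exact h2 _ ha1 _ hb1 hab
    · intro S hS S' hS' h
      have h1 : ∀ S ∈ adm (A \ nb y), y ∉ S := fun S hS h =>
        (Finset.mem_sdiff.1 (((mem_adm _ _).1 hS).1 h)).2 (mem_self_nb y)
      rw [← Finset.erase_insert (h1 S hS), ← Finset.erase_insert (h1 S' hS'), h]
    · intro S hS
      obtain ⟨hS, hyS⟩ := Finset.mem_filter.1 hS
      obtain ⟨h1, h2⟩ := (mem_adm _ _).1 hS
      refine ⟨S.erase y, (mem_adm _ _).2 ⟨?_, ?_⟩, Finset.insert_erase hyS⟩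
      · intro a ha
        obtain ⟨hay, haS⟩ := Finset.mem_erase.1 ha
        have := h2 a haS y hyS hay
        rw [Finset.mem_sdiff, mem_nb]
        exact ⟨h1 haS, by omega⟩
      · intro a ha b hb
        exact h2 a (Finset.mem_of_mem_erase ha) b (Finset.mem_of_mem_erase hb)
    · intro S _; rfl

lemma card_ins (A S : Finset ℤ) (y : ℤ) (hS : S ∈ adm (A \ nb y)) :
    ((insert y S).card : ℤ) = S.card + 1 := by
  rw [Finset.card_insert_of_notMem]
  · push_cast; ring
  · exact fun h => (Finset.mem_sdiff.1 (((mem_adm _ _).1 hS).1 h)).2 (mem_self_nb y)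

/-- general decomposition at size `n` -/
def C (n : ℤ) : Prop := ∀ A K : Finset ℤ, Disjoint A K →
  G (A ∪ K) n = ∑ S ∈ adm A, G (N S ∪ K) (n - S.card)

/-- one-piece decomposition at size `n` -/
def R (n : ℤ) : Prop := ∀ (M : Finset ℤ), ∀ x ∈ M,
  G M n = G (M.erase x) n + G (M ∪ nb x) (n - 1)

lemma R_of_C (n : ℤ) (h : C (n - 1)) : R n := by
  intro M x hx
  rw [G_sum M n, sum_adm M x hx, ← G_sum]
  congr 1
  rw [← Finset.sdiff_union_self_eq_union, h _ _ Finset.sdiff_disjoint]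
  apply Finset.sum_congr rfl
  intro S hS
  rw [N_insert, card_ins M S x hS]
  congr 1; ring

lemma C_of_R (n : ℤ) (h : C (n - 1)) (hR : R n) : C n := by
  intro A
  induction A using Finset.strongInduction with
  | H A ih =>
    intro K hAK
    rcases A.eq_empty_or_nonempty with rfl | ⟨y, hy⟩
    · have : adm ∅ = {∅} := by
        ext S; rw [mem_adm]; simp only [Finset.subset_empty, Finset.mem_singleton]
        constructor
        · exact fun h => h.1
        · rintro rfl; exact ⟨rfl, by simp [Adm]⟩
      rw [this]; simp [N]
    · have hyK : y ∉ K := Finset.disjoint_left.1 hAK hy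
      rw [sum_adm A y hy, hR (A ∪ K) y (Finset.mem_union_left _ hy), Finset.erase_union_distrib,
        Finset.erase_eq_of_notMem hyK,
        ih (A.erase y) (Finset.erase_ssubset hy) K (hAK.mono_left (Finset.erase_subset _ _))]
      congr 1
      have e : A ∪ K ∪ nb y = (A \ nb y) ∪ (K ∪ nb y) := by
        ext z; simp only [Finset.mem_union, Finset.mem_sdiff]; tauto
      rw [e, h (A \ nb y) (K ∪ nb y)]
      · apply Finset.sum_congr rfl
        intro S hS
        rw [N_insert, card_ins A S y hS]
        congr 1
        · ext z; simp only [Finset.mem_union]; tauto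
        · ring
      · rw [Finset.disjoint_union_right]
        exact ⟨hAK.mono_left Finset.sdiff_subset, Finset.sdiff_disjoint⟩

lemma C_all (k : ℕ) : ∀ n : ℤ, n < k → C n := by
  induction k with
  | zero =>
    intro n hn A K _
    rw [G_neg _ _ (by simpa using hn)]
    symm
    apply Finset.sum_eq_zero
    intro S _
    apply G_neg
    push_cast at hn; omega
  | succ k ih =>
    intro n hn
    have h : C (n - 1) := ih _ (by push_cast at hn; omega)
    exact C_of_R n h (R_of_C n h)

lemma R_all (n : ℤ) : R n := R_of_C n (C_all (n.toNat + 1) _ (by omega))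

/-- intervals -/
lemma G_Icc (r n : ℤ) (hr : 0 ≤ r) :
    G (Finset.Icc (-1) r) n = G (Finset.Icc (-1) (r - 1)) n + G (Finset.Icc (-1) (r + 1)) (n - 1) := by
  rw [R_all n (Finset.Icc (-1) r) r (by simp; omega)]
  congr 2
  · ext z; simp only [Finset.mem_erase, Finset.mem_Icc]; omega
  · ext z; simp only [Finset.mem_union, nb, Finset.mem_Icc]; omega

/-- convex base -/
def cb (b : ℕ) : Finset ℤ := (Finset.range b).image fun i : ℕ => 2 * (i : ℤ)

lemma mem_cb (b : ℕ) (x : ℤ) : x ∈ cb b ↔ ∃ i : ℕ, i < b ∧ x = 2 * (i : ℤ) := by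
  simp [cb, eq_comm]

lemma card_cb (b : ℕ) : (cb b).card = b := by
  unfold cb
  rw [Finset.card_image_of_injective, Finset.card_range]
  intro i j h; simpa using h

lemma adm_cb (b : ℕ) : Adm (cb b) := by
  intro x hx y hy hxy
  obtain ⟨i, _, rfl⟩ := (mem_cb _ _).1 hx
  obtain ⟨j, _, rfl⟩ := (mem_cb _ _).1 hy
  rw [le_abs]; omega

lemma N_cb (b : ℕ) (hb : 1 ≤ b) : N (cb b) = Finset.Icc (-1) (2 * (b : ℤ) - 1) := by
  ext x
  rw [mem_N, Finset.mem_Icc]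
  constructor
  · rintro ⟨y, hy, h⟩
    obtain ⟨i, hi, rfl⟩ := (mem_cb _ _).1 hy
    rw [abs_le] at h; omega
  · intro h
    by_cases hx : x = 2 * (b : ℤ) - 1
    · refine ⟨2 * ((b - 1 : ℕ) : ℤ), (mem_cb _ _).2 ⟨b - 1, by omega, rfl⟩, ?_⟩
      rw [abs_le]; omega
    · refine ⟨2 * (((x + 1) / 2).toNat : ℤ), (mem_cb _ _).2 ⟨_, by omega, rfl⟩, ?_⟩
      rw [abs_le]; omega

lemma card_tower (n b : ℕ) (hb : 1 ≤ b) :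
    Nat.card {T : Finset (ℤ × ℕ) // IsDominoTower n b T} =
      G (Finset.Icc (-1) (2 * (b : ℤ) - 1)) (n - b) := by
  have e := equivB (cb b) (adm_cb b) n
  rw [N_cb b hb, card_cb] at e
  unfold G
  rw [← Nat.card_congr e]
  apply Nat.card_congr
  apply Equiv.subtypeEquivRight
  intro T
  simp only [IsDominoTower, mem_cb, Ok, Nat.cast_inj]

end DT

theorem domino_tower_recurrence (n b : ℕ) (hn : 2 ≤ n) (hb : 2 ≤ b) :
    Nat.card {T : Finset (ℤ × ℕ) // IsDominoTower n b T} =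
      Nat.card {T : Finset (ℤ × ℕ) // IsDominoTower (n - 1) (b - 1) T} +
      2 * Nat.card {T : Finset (ℤ × ℕ) // IsDominoTower (n - 1) b T} +
      Nat.card {T : Finset (ℤ × ℕ) // IsDominoTower (n - 1) (b + 1) T} := by
  rw [DT.card_tower n b (by omega), DT.card_tower (n - 1) (b - 1) (by omega),
    DT.card_tower (n - 1) b (by omega), DT.card_tower (n - 1) (b + 1) (by omega)]
  push_cast [Nat.cast_sub (show 1 ≤ n by omega), Nat.cast_sub (show 1 ≤ b by omega)]
  have h1 := DT.G_Icc (2 * (b : ℤ) - 1) (n - b) (by omega)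
  have h2 := DT.G_Icc (2 * (b : ℤ) - 1 - 1) (n - b) (by omega)
  have h3 := DT.G_Icc (2 * (b : ℤ) - 1 + 1) (n - b - 1) (by omega)
  rw [h1, h2, h3]
  ring_nf
end

section
/- For every real number x with 0 ≤ x < 1/4, the series Σ_{n≥2} C(2n−3, n−1)·x^n converges and equals (x/2)·((1−√(1−4x))/√(1−4x)). -/
lemma aux_choose (n : ℕ) :
    Ring.choose (-(1 / 2) : ℝ) n * (-4) ^ n = (Nat.centralBinom n : ℝ) := by
  induction n with
  | zero => simp
  | succ n ih =>
    have h := Ring.choose_smul_choose (-(1 / 2) : ℝ) (Nat.le_succ n)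
    simp only [Nat.succ_eq_add_one, Nat.choose_succ_self_right, Nat.add_sub_cancel_left,
      Ring.choose_one_right, nsmul_eq_mul] at h
    have h2 : ((n : ℝ) + 1) * (Nat.centralBinom (n + 1) : ℝ)
        = 2 * (2 * n + 1) * Nat.centralBinom n := by
      exact_mod_cast Nat.succ_mul_centralBinom_succ n
    have hn : ((n : ℝ) + 1) ≠ 0 := by positivity
    apply mul_left_cancel₀ hn
    rw [h2, ← ih, pow_succ]
    push_cast at h
    linear_combination (-4) ^ n * (-4) * h

lemma aux_sum (x : ℝ) (hx0 : 0 ≤ x) (hx : x < 1 / 4) :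
    HasSum (fun n : ℕ => (Nat.centralBinom n : ℝ) * x ^ n) (Real.sqrt (1 - 4 * x))⁻¹ := by
  have h := (Real.one_add_rpow_hasFPowerSeriesOnBall_zero (a := -(1 / 2))).hasSum
    (y := -4 * x) (by
      rw [show (1 : ENNReal) = ENNReal.ofReal 1 by simp, Metric.eball_ofReal]
      simp [abs_of_nonneg hx0]; linarith)
  convert! h using 1
  · funext n
    rw [← aux_choose]
    rw [binomialSeries_apply]
    simp only [List.ofFn_const, List.prod_replicate, smul_eq_mul, mul_pow]
    ring
  · rw [Real.rpow_neg (by linarith), ← Real.sqrt_eq_rpow]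
    congr 2
    ring

theorem central_binomial_type_series (x : ℝ) (hx0 : 0 ≤ x) (hx : x < 1 / 4) :
    HasSum (fun n : ℕ => (Nat.choose (2 * (n + 2) - 3) (n + 1) : ℝ) * x ^ (n + 2))
      ((x / 2) * ((1 - Real.sqrt (1 - 4 * x)) / Real.sqrt (1 - 4 * x))) := by
  have h := ((hasSum_nat_add_iff' 1).mpr (aux_sum x hx0 hx)).mul_left (x / 2)
  have hs : 0 < Real.sqrt (1 - 4 * x) := Real.sqrt_pos.mpr (by linarith)
  convert! h using 1
  · funext n
    have hc : Nat.centralBinom (n + 1) = 2 * Nat.choose (2 * (n + 2) - 3) (n + 1) := by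
      rw [show 2 * (n + 2) - 3 = 2 * n + 1 by omega, Nat.centralBinom,
        show 2 * (n + 1) = (2 * n + 1) + 1 by ring, Nat.choose_succ_succ,
        Nat.choose_symm_half]
      ring
    rw [hc]
    push_cast
    ring
  · rw [Finset.sum_range_one, Nat.centralBinom_zero, pow_zero, sub_div, div_self hs.ne']
    simp
end

section
/- For all integers k ≥ 1 and n ≥ b ≥ 1, the number of (n,b)-k-omino towers equals the binomial coefficient C(kn−1, n−b). -/
/-- `T` is an (n,b)-k-omino tower: a finite set of pairs `(x, y)` where `(x, y) ∈ T` means a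
horizontal 1×k block occupies columns `x, x+1, …, x+k-1` at level `y`. -/
def IsKominoTower (k n b : ℕ) (T : Finset (ℤ × ℕ)) : Prop :=
  T.card = n ∧
  (∀ x : ℤ, (x, 0) ∈ T ↔ ∃ i : ℕ, i < b ∧ x = (k : ℤ) * i) ∧
  (∀ x x' : ℤ, ∀ y : ℕ, (x, y) ∈ T → (x', y) ∈ T → x ≠ x' → (k : ℤ) ≤ |x - x'|) ∧
  (∀ x : ℤ, ∀ y : ℕ, (x, y + 1) ∈ T → ∃ x' : ℤ, (x', y) ∈ T ∧ |x - x'| ≤ (k : ℤ) - 1)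

/-- Heaps of `m` blocks lying above the height profile `h`, whose minimal blocks all start in
`[a, a + L)`. -/
structure KGood (k : ℕ) (h : ℤ → ℕ) (a : ℤ) (L m : ℕ) (T : Finset (ℤ × ℕ)) : Prop where
  card : T.card = m
  above : ∀ x y, (x, y) ∈ T → ∀ c, x ≤ c → c < x + k → h c ≤ y
  disj : ∀ x x' y, (x, y) ∈ T → (x', y) ∈ T → x - x' < k → x' - x < k → x = x'
  supp : ∀ x y, (x, y) ∈ T → (∃ c, x ≤ c ∧ c < x + k ∧ h c = y) ∨
    (∃ x' y', (x', y') ∈ T ∧ y' + 1 = y ∧ x - x' < k ∧ x' - x < k)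
  mins : ∀ x y, (x, y) ∈ T →
    (∀ x' y', (x', y') ∈ T → x - x' < k → x' - x < k → y ≤ y') → a ≤ x ∧ x < a + L

/-- Maximal height of `h` below a block at `p`. -/
noncomputable def kTop (k : ℕ) (h : ℤ → ℕ) (p : ℤ) : ℕ := (Finset.Ico p (p + k)).sup h

/-- The profile after a block has been placed at `p`. -/
noncomputable def kUpd (k : ℕ) (h : ℤ → ℕ) (p : ℤ) : ℤ → ℕ :=
  fun c => if p ≤ c ∧ c < p + k then kTop k h p + 1 else h c

lemma kTop_ge (k : ℕ) (h : ℤ → ℕ) (p c : ℤ) (h1 : p ≤ c) (h2 : c < p + k) : h c ≤ kTop k h p :=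
  Finset.le_sup (f := h) (by simp [h1, h2])

lemma kTop_att (k : ℕ) (hk : 1 ≤ k) (h : ℤ → ℕ) (p : ℤ) :
    ∃ c, p ≤ c ∧ c < p + k ∧ h c = kTop k h p := by
  obtain ⟨c, hc, e⟩ := Finset.exists_mem_eq_sup (Finset.Ico p (p + k))
    ⟨p, by simp; omega⟩ h
  simp at hc
  exact ⟨c, hc.1, hc.2, e.symm⟩

lemma kUpd_in {k : ℕ} {h : ℤ → ℕ} {p c : ℤ} (h1 : p ≤ c) (h2 : c < p + k) :
    kUpd k h p c = kTop k h p + 1 := by simp [kUpd, h1, h2]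

lemma kUpd_out {k : ℕ} {h : ℤ → ℕ} {p c : ℤ} (h1 : ¬ (p ≤ c ∧ c < p + k)) :
    kUpd k h p c = h c := by simp only [kUpd, if_neg h1]

lemma kUpd_ge (k : ℕ) (h : ℤ → ℕ) (p c : ℤ) : h c ≤ kUpd k h p c := by
  by_cases hc : p ≤ c ∧ c < p + k
  · rw [kUpd_in hc.1 hc.2]
    have := kTop_ge k h p c hc.1 hc.2
    omega
  · rw [kUpd_out hc]

/-- New left end. -/
def kLeft (k : ℕ) (a : ℤ) (L : ℕ) : ℤ := min a (a + L - k + 1)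

lemma kGood_top (k : ℕ) (hk : 1 ≤ k) (h : ℤ → ℕ) (a b : ℤ) (p : ℤ) (L m : ℕ) (T : Finset (ℤ × ℕ))
    (hT : KGood k (kUpd k h p) b L m T) (x : ℤ) (y : ℕ) (hx : (x, y) ∈ T)
    (h1 : x - p < k) (h2 : p - x < k) : kTop k h p + 1 ≤ y := by
  have := hT.above x y hx (max x p) (by omega) (by omega)
  rwa [kUpd_in (by omega) (by omega)] at this

lemma kGood_insert (k : ℕ) (hk : 1 ≤ k) (h : ℤ → ℕ) (a : ℤ) (L m : ℕ) (T : Finset (ℤ × ℕ))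
    (hT : KGood k (kUpd k h (a + L)) (kLeft k a L) (max (L + k) (2 * k - 1)) m T) :
    KGood k h a (L + 1) (m + 1) (insert (a + L, kTop k h (a + L)) T) := by
  have key := kGood_top k hk h a _ (a + L) _ m T hT
  generalize hp : a + (L : ℤ) = p at *
  have hnot : (p, kTop k h p) ∉ T := by
    intro hm
    have := key p _ hm (by omega) (by omega)
    omega
  refine ⟨?_, ?_, ?_, ?_, ?_⟩
  · rw [Finset.card_insert_of_notMem hnot, hT.card]
  · intro x y hx c h1 h2
    rw [Finset.mem_insert, Prod.mk.injEq] at hx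
    rcases hx with ⟨rfl, rfl⟩ | hx
    · exact kTop_ge k h x c h1 h2
    · exact (kUpd_ge k h p c).trans (hT.above x y hx c h1 h2)
  · intro x x' y hx hx' h1 h2
    rw [Finset.mem_insert, Prod.mk.injEq] at hx hx'
    rcases hx with ⟨rfl, rfl⟩ | hx <;> rcases hx' with ⟨rfl, e⟩ | hx'
    · rfl
    · have := key _ _ hx' (by omega) (by omega)
      omega
    · have := key _ _ hx (by omega) (by omega)
      omega
    · exact hT.disj x x' y hx hx' h1 h2
  · intro x y hx
    rw [Finset.mem_insert, Prod.mk.injEq] at hx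
    rcases hx with ⟨rfl, rfl⟩ | hx
    · exact Or.inl (kTop_att k hk h x)
    · rcases hT.supp x y hx with ⟨c, h1, h2, h3⟩ | ⟨x', y', h1, h2⟩
      · by_cases hc : p ≤ c ∧ c < p + k
        · rw [kUpd_in hc.1 hc.2] at h3
          exact Or.inr ⟨p, _, Finset.mem_insert_self _ _, h3, by omega, by omega⟩
        · rw [kUpd_out hc] at h3
          exact Or.inl ⟨c, h1, h2, h3⟩
      · exact Or.inr ⟨x', y', Finset.mem_insert_of_mem h1, h2⟩
  · intro x y hx hmin
    rw [Finset.mem_insert, Prod.mk.injEq] at hx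
    rcases hx with ⟨rfl, rfl⟩ | hx
    · push_cast; omega
    · have h1 := hT.mins x y hx (fun x' y' hx' => hmin x' y' (Finset.mem_insert_of_mem hx'))
      have h2 : ¬ (x - p < k ∧ p - x < k) := by
        rintro ⟨h3, h4⟩
        have := hmin p _ (Finset.mem_insert_self _ _) h3 h4
        have := key x y hx h3 h4
        omega
      unfold kLeft at h1
      push_cast at *
      omega

lemma kGood_erase (k : ℕ) (hk : 1 ≤ k) (h : ℤ → ℕ) (a : ℤ) (L m : ℕ) (T : Finset (ℤ × ℕ))
    (hT : KGood k h a (L + 1) (m + 1) T) (y : ℕ) (hy : (a + (L : ℤ), y) ∈ T)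
    (hmin : ∀ x' y', (x', y') ∈ T → a + L - x' < k → x' - (a + L) < k → y ≤ y') :
    y = kTop k h (a + L) ∧
    KGood k (kUpd k h (a + L)) (kLeft k a L) (max (L + k) (2 * k - 1)) m (T.erase (a + L, y)) := by
  generalize hp : a + (L : ℤ) = p at *
  have hyt : y = kTop k h p := by
    apply le_antisymm
    · rcases hT.supp p y hy with ⟨c, h1, h2, h3⟩ | ⟨x', y', h1, h2, h3, h4⟩
      · rw [← h3]; exact kTop_ge k h p c h1 h2
      · have := hmin x' y' h1 h3 h4
        omega
    · obtain ⟨c, h1, h2, h3⟩ := kTop_att k hk h p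
      rw [← h3]
      exact hT.above p y hy c h1 h2
  have key : ∀ x z, (x, z) ∈ T.erase (p, y) → x - p < k → p - x < k → y + 1 ≤ z := by
    intro x z hx h1 h2
    rw [Finset.mem_erase, Ne, Prod.mk.injEq] at hx
    have h3 := hmin x z hx.2 h2 h1
    rcases h3.lt_or_eq with h4 | h4
    · exact h4
    · subst h4
      exact absurd ⟨hT.disj x p y hx.2 hy h1 h2, rfl⟩ hx.1
  refine ⟨hyt, ?_, ?_, ?_, ?_, ?_⟩
  · rw [Finset.card_erase_of_mem hy, hT.card]; rfl
  · intro x z hx c h1 h2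
    by_cases hc : p ≤ c ∧ c < p + k
    · rw [kUpd_in hc.1 hc.2, ← hyt]
      exact key x z hx (by omega) (by omega)
    · rw [kUpd_out hc]
      exact hT.above x z (Finset.mem_of_mem_erase hx) c h1 h2
  · intro x x' z hx hx'
    exact hT.disj x x' z (Finset.mem_of_mem_erase hx) (Finset.mem_of_mem_erase hx')
  · intro x z hx
    rcases hT.supp x z (Finset.mem_of_mem_erase hx) with ⟨c, h1, h2, h3⟩ | ⟨x', y', h1, h2, h3, h4⟩
    · by_cases hc : p ≤ c ∧ c < p + k
      · have := key x z hx (by omega) (by omega)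
        have := kTop_ge k h p c hc.1 hc.2
        omega
      · exact Or.inl ⟨c, h1, h2, by rw [kUpd_out hc]; exact h3⟩
    · by_cases he : (x', y') = (p, y)
      · rw [Prod.mk.injEq] at he
        obtain ⟨rfl, rfl⟩ := he
        refine Or.inl ⟨max x x', by omega, by omega, ?_⟩
        rw [kUpd_in (by omega) (by omega), ← hyt]
        exact h2
      · exact Or.inr ⟨x', y', Finset.mem_erase.2 ⟨he, h1⟩, h2, h3, h4⟩
  · intro x z hx hm
    unfold kLeft
    by_cases ho : x - p < k ∧ p - x < k
    · push_cast
      omega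
    · have := hT.mins x z (Finset.mem_of_mem_erase hx) (by
        intro x' y' hx' h1 h2
        by_cases he : (x', y') = (p, y)
        · rw [Prod.mk.injEq] at he
          obtain ⟨rfl, rfl⟩ := he
          exact absurd ⟨h1, h2⟩ ho
        · exact hm x' y' (Finset.mem_erase.2 ⟨he, hx'⟩) h1 h2)
      push_cast at *
      omega

lemma kGood_step (k : ℕ) (hk : 1 ≤ k) (h : ℤ → ℕ) (a : ℤ) (L m : ℕ) :
    {T | KGood k h a (L + 1) (m + 1) T} = {T | KGood k h a L (m + 1) T} ∪
      (fun T => insert (a + (L : ℤ), kTop k h (a + L)) T) ''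
        {T | KGood k (kUpd k h (a + L)) (kLeft k a L) (max (L + k) (2 * k - 1)) m T} := by
  ext T
  simp only [Set.mem_ofPred_eq, Set.mem_union, Set.mem_image]
  constructor
  · intro hT
    by_cases hy : ∃ y, (a + (L : ℤ), y) ∈ T ∧
      ∀ x' y', (x', y') ∈ T → a + L - x' < k → x' - (a + L) < k → y ≤ y'
    · obtain ⟨y, hy, hmin⟩ := hy
      obtain ⟨e, hg⟩ := kGood_erase k hk h a L m T hT y hy hmin
      refine Or.inr ⟨_, hg, ?_⟩
      rw [← e, Finset.insert_erase hy]
    · refine Or.inl ⟨hT.card, hT.above, hT.disj, hT.supp, ?_⟩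
      intro x y hx hm
      have := hT.mins x y hx hm
      have : x ≠ a + L := by
        rintro rfl
        exact hy ⟨y, hx, hm⟩
      push_cast at *
      omega
  · rintro (hT | ⟨T', hT', rfl⟩)
    · refine ⟨hT.card, hT.above, hT.disj, hT.supp, ?_⟩
      intro x y hx hm
      have := hT.mins x y hx hm
      push_cast at *
      omega
    · exact kGood_insert k hk h a L m T' hT'

lemma kGood_encard_step (k : ℕ) (hk : 1 ≤ k) (h : ℤ → ℕ) (a : ℤ) (L m : ℕ) :
    {T | KGood k h a (L + 1) (m + 1) T}.encard = {T | KGood k h a L (m + 1) T}.encard +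
        {T | KGood k (kUpd k h (a + L)) (kLeft k a L) (max (L + k) (2 * k - 1)) m T}.encard := by
  rw [kGood_step k hk, Set.encard_union_eq, Set.InjOn.encard_image]
  · intro T hT T' hT' e
    have aux : ∀ T, KGood k (kUpd k h (a + L)) (kLeft k a L) (max (L + k) (2 * k - 1)) m T →
        (a + (L : ℤ), kTop k h (a + L)) ∉ T := by
      intro T hT hm
      have := kGood_top k hk h a _ _ _ _ T hT _ _ hm (by omega) (by omega)
      omega
    have e' := congrArg (fun S => Finset.erase S (a + (L : ℤ), kTop k h (a + L))) e
    simpa [Finset.erase_insert (aux T hT), Finset.erase_insert (aux T' hT')] using e'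
  · rw [Set.disjoint_left]
    rintro _ hT ⟨T, hT', rfl⟩
    have := KGood.mins hT (a + L) _ (Finset.mem_insert_self _ _) (by
      intro x' y' hx' h1 h2
      rw [Finset.mem_insert, Prod.mk.injEq] at hx'
      rcases hx' with ⟨rfl, rfl⟩ | hx'
      · exact le_rfl
      · have := kGood_top k hk h a _ _ _ _ T hT' _ _ hx' h2 h1
        omega)
    omega

/-- The counting recursion. -/
def kCount (k : ℕ) : ℕ → ℕ → ℕ
  | 0, _ => 1
  | _ + 1, 0 => 0
  | m + 1, L + 1 => kCount k (m + 1) L + kCount k m (max (L + k) (2 * k - 1))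
termination_by m L => (m, L)

lemma kGood_encard (k : ℕ) (hk : 1 ≤ k) (m L : ℕ) : ∀ (h : ℤ → ℕ) (a : ℤ),
    {T | KGood k h a L m T}.encard = kCount k m L := by
  induction m generalizing L with
  | zero =>
    intro h a
    have : {T | KGood k h a L 0 T} = {∅} := by
      ext T
      simp only [Set.mem_ofPred_eq, Set.mem_singleton_iff]
      constructor
      · intro hT; exact Finset.card_eq_zero.1 hT.card
      · rintro rfl
        constructor <;> simp
    rw [this]
    simp [kCount]
  | succ m ih =>
    induction L with
    | zero =>
      intro h a
      have : {T | KGood k h a 0 (m + 1) T} = ∅ := by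
        ext T
        simp only [Set.mem_ofPred_eq, Set.mem_empty_iff_false, iff_false]
        intro hT
        have hne : T.Nonempty := by
          rw [← Finset.card_pos, hT.card]; omega
        obtain ⟨⟨x, y⟩, hx, hm⟩ := Finset.exists_min_image T Prod.snd hne
        have := hT.mins x y hx (fun x' y' hx' _ _ => hm _ hx')
        push_cast at this
        omega
      rw [this]
      simp [kCount]
    | succ L ihL =>
      intro h a
      rw [kGood_encard_step k hk, ihL, ih, kCount]
      push_cast
      rfl

lemma kCount_eq (k : ℕ) (hk : 1 ≤ k) (m : ℕ) : ∀ L, k ≤ L →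
    kCount k m L = Nat.choose (k * m + L - k) m := by
  induction m with
  | zero => intro L _; simp [kCount]
  | succ m ih =>
    have small : ∀ L, L ≤ k → kCount k (m + 1) L = L * Nat.choose (k * (m + 1) - 1) m := by
      intro L
      induction L with
      | zero => intro _; simp [kCount]
      | succ L ihL =>
        intro hL
        rw [kCount, ihL (by omega), show max (L + k) (2 * k - 1) = 2 * k - 1 by omega,
          ih _ (by omega), show k * m + (2 * k - 1) - k = k * (m + 1) - 1 by
            rw [mul_add]; omega]
        ring
    intro L hL
    induction L, hL using Nat.le_induction with
    | base =>
      rw [small k le_rfl, Nat.add_sub_cancel]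
      have hpos : 1 ≤ k * (m + 1) := Nat.mul_pos hk (Nat.succ_pos m)
      have := Nat.add_one_mul_choose_eq (k * (m + 1) - 1) m
      rw [Nat.sub_add_cancel hpos] at this
      apply Nat.eq_of_mul_eq_mul_right (Nat.succ_pos m)
      rw [Nat.succ_eq_add_one, ← this]; ring
    | succ L hL ihL =>
      rw [kCount, ihL, show max (L + k) (2 * k - 1) = L + k by omega, ih _ (by omega),
        show k * (m + 1) + (L + 1) - k = (k * m + L) + 1 by rw [mul_add]; omega,
        show k * (m + 1) + L - k = k * m + L by rw [mul_add]; omega,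
        show k * m + (L + k) - k = k * m + L by omega, Nat.choose_succ_succ]
      ring

/-- The base blocks. -/
def kBase (k b : ℕ) : Finset (ℤ × ℕ) := (Finset.range b).image (fun i : ℕ => ((k : ℤ) * i, 0))

lemma mem_kBase (k b : ℕ) (x : ℤ) (y : ℕ) :
    (x, y) ∈ kBase k b ↔ y = 0 ∧ ∃ i : ℕ, i < b ∧ x = (k : ℤ) * i := by
  simp only [kBase, Finset.mem_image, Finset.mem_range, Prod.mk.injEq]
  constructor
  · rintro ⟨i, h1, h2, h3⟩; exact ⟨h3.symm, i, h1, h2.symm⟩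
  · rintro ⟨h3, i, h1, h2⟩; exact ⟨i, h1, h2.symm, h3.symm⟩

lemma kBase_card (k b : ℕ) (hk : 1 ≤ k) : (kBase k b).card = b := by
  rw [kBase, Finset.card_image_of_injective, Finset.card_range]
  intro i j e
  simp only [Prod.mk.injEq, and_true] at e
  have : (k : ℤ) ≠ 0 := by omega
  exact_mod_cast mul_left_cancel₀ this e

lemma kGood_base_disj (k b : ℕ) (hk : 1 ≤ k) (a : ℤ) (L m : ℕ) (T : Finset (ℤ × ℕ))
    (hT : KGood k (fun _ => 1) a L m T) : Disjoint T (kBase k b) := by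
  rw [Finset.disjoint_left]
  rintro ⟨x, y⟩ h1 h2
  have := hT.above x y h1 x le_rfl (by omega)
  rw [mem_kBase] at h2
  omega

lemma kTower_to (k n b : ℕ) (hk : 1 ≤ k) (hbn : b ≤ n) (T : Finset (ℤ × ℕ))
    (hT : IsKominoTower k n b T) :
    KGood k (fun _ => 1) (1 - k) (k * b + k - 1) (n - b) (T \ kBase k b) ∧ kBase k b ⊆ T := by
  obtain ⟨hc, h0, hd, hs⟩ := hT
  have hsub : kBase k b ⊆ T := by
    rintro ⟨x, y⟩ h
    rw [mem_kBase] at h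
    obtain ⟨rfl, h⟩ := h
    exact (h0 x).2 h
  have hmem : ∀ x y, (x, y) ∈ T \ kBase k b ↔ (x, y) ∈ T ∧ 1 ≤ y := by
    intro x y
    rw [Finset.mem_sdiff, mem_kBase]
    constructor
    · rintro ⟨h1, h2⟩
      refine ⟨h1, ?_⟩
      by_contra hy
      obtain rfl : y = 0 := by omega
      exact h2 ⟨rfl, (h0 x).1 h1⟩
    · rintro ⟨h1, h2⟩
      exact ⟨h1, fun h => by omega⟩
  refine ⟨⟨?_, ?_, ?_, ?_, ?_⟩, hsub⟩
  · rw [Finset.card_sdiff_of_subset hsub, hc, kBase_card k b hk]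
  · intro x y hx c _ _
    exact ((hmem x y).1 hx).2
  · intro x x' y hx hx' h1 h2
    by_contra hne
    have := hd x x' y ((hmem _ _).1 hx).1 ((hmem _ _).1 hx').1 hne
    have := abs_lt.2 ⟨by omega, h1⟩
    omega
  · intro x y hx
    rw [hmem] at hx
    obtain ⟨h1, h2⟩ := hx
    obtain ⟨y, rfl⟩ : ∃ z, y = z + 1 := ⟨y - 1, by omega⟩
    obtain ⟨x', h3, h4⟩ := hs x y h1
    rw [abs_le] at h4
    rcases Nat.eq_zero_or_pos y with rfl | hy
    · exact Or.inl ⟨x, le_rfl, by omega, rfl⟩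
    · exact Or.inr ⟨x', y, (hmem _ _).2 ⟨h3, hy⟩, rfl, by omega, by omega⟩
  · intro x y hx hm
    rw [hmem] at hx
    obtain ⟨h1, h2⟩ := hx
    obtain ⟨y, rfl⟩ : ∃ z, y = z + 1 := ⟨y - 1, by omega⟩
    obtain ⟨x', h3, h4⟩ := hs x y h1
    rw [abs_le] at h4
    rcases Nat.eq_zero_or_pos y with rfl | hy
    · obtain ⟨i, hi, rfl⟩ := (h0 x').1 h3
      have e1 : (0 : ℤ) ≤ k * i := by positivity
      have e2 : k * i + k ≤ k * b := by
        calc k * i + k = k * (i + 1) := by ring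
          _ ≤ k * b := Nat.mul_le_mul_left _ hi
      zify at e2
      have e3 : ((k * b + k - 1 : ℕ) : ℤ) = k * b + k - 1 := by
        rw [Nat.cast_sub (by omega)]; push_cast; ring
      rw [e3]
      omega
    · have := hm x' y ((hmem _ _).2 ⟨h3, hy⟩) (by omega) (by omega)
      omega

lemma kTower_of (k n b : ℕ) (hk : 1 ≤ k) (hb : 1 ≤ b) (hbn : b ≤ n) (T : Finset (ℤ × ℕ))
    (hT : KGood k (fun _ => 1) (1 - k) (k * b + k - 1) (n - b) T) :
    IsKominoTower k n b (T ∪ kBase k b) := by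
  have hpos : ∀ x y, (x, y) ∈ T → 1 ≤ y := fun x y h => hT.above x y h x le_rfl (by omega)
  refine ⟨?_, ?_, ?_, ?_⟩
  · rw [Finset.card_union_of_disjoint (kGood_base_disj k b hk _ _ _ T hT), hT.card,
      kBase_card k b hk]
    omega
  · intro x
    rw [Finset.mem_union, mem_kBase]
    constructor
    · rintro (h | h)
      · have := hpos _ _ h
        omega
      · exact h.2
    · intro h
      exact Or.inr ⟨rfl, h⟩
  · intro x x' y hx hx' hne
    rw [Finset.mem_union, mem_kBase] at hx hx'
    rcases hx with hx | ⟨rfl, i, hi, rfl⟩ <;> rcases hx' with hx' | ⟨h0, j, hj, rfl⟩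
    · by_contra hlt
      rw [not_le, abs_lt] at hlt
      exact hne (hT.disj x x' y hx hx' (by omega) (by omega))
    · have := hpos _ _ hx
      omega
    · have := hpos _ _ hx'
      omega
    · rw [← mul_sub, abs_mul, Nat.abs_cast]
      have : (i : ℤ) - j ≠ 0 := by
        intro e
        exact hne (by rw [sub_eq_zero.1 e])
      have := Int.one_le_abs this
      nlinarith
  · intro x y hx
    rw [Finset.mem_union, mem_kBase] at hx
    have hx : (x, y + 1) ∈ T := by
      rcases hx with hx | hx
      · exact hx
      · omega
    rcases Nat.eq_zero_or_pos y with rfl | hy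
    · have hm := hT.mins x _ hx (fun x' y' h _ _ => hpos _ _ h)
      have e3 : ((k * b + k - 1 : ℕ) : ℤ) = k * b + k - 1 := by
        rw [Nat.cast_sub (by omega)]; push_cast; ring
      rw [e3] at hm
      obtain ⟨i, hi, h1⟩ : ∃ i : ℕ, i < b ∧ |x - k * i| ≤ (k : ℤ) - 1 := by
        rcases lt_or_ge x 0 with hx0 | hx0
        · refine ⟨0, hb, ?_⟩
          rw [abs_le]; push_cast; omega
        · have hkp : (0 : ℤ) < k := by omega
          have q0 : 0 ≤ x / k := Int.ediv_nonneg hx0 hkp.le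
          have q1 : x / k < b := Int.ediv_lt_of_lt_mul hkp (by rw [mul_comm]; omega)
          refine ⟨(x / k).toNat, by omega, ?_⟩
          rw [Int.toNat_of_nonneg q0]
          have r0 := Int.emod_nonneg x hkp.ne'
          have r1 := Int.emod_lt_of_pos x hkp
          have r2 := Int.mul_ediv_add_emod x k
          rw [abs_le]
          constructor <;> linarith
      refine ⟨k * i, ?_, h1⟩
      rw [Finset.mem_union, mem_kBase]
      exact Or.inr ⟨rfl, i, hi, rfl⟩
    · rcases hT.supp x _ hx with ⟨c, _, _, h⟩ | ⟨x', y', h1, h2, h3, h4⟩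
      · simp at h
        omega
      · obtain rfl : y' = y := by omega
        exact ⟨x', Finset.mem_union_left _ h1, abs_le.2 ⟨by omega, by omega⟩⟩

theorem komino_tower_count (k n b : ℕ) (hk : 1 ≤ k) (hb : 1 ≤ b) (hbn : b ≤ n) :
    Nat.card {T : Finset (ℤ × ℕ) // IsKominoTower k n b T} =
      Nat.choose (k * n - 1) (n - b) := by
  have hset : {T | IsKominoTower k n b T} = (fun T => T ∪ kBase k b) ''
      {T | KGood k (fun _ => 1) (1 - k) (k * b + k - 1) (n - b) T} := by
    ext T
    simp only [Set.mem_ofPred_eq, Set.mem_image]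
    constructor
    · intro hT
      obtain ⟨h1, h2⟩ := kTower_to k n b hk hbn T hT
      exact ⟨_, h1, Finset.sdiff_union_of_subset h2⟩
    · rintro ⟨T', hT', rfl⟩
      exact kTower_of k n b hk hb hbn T' hT'
  have hkb : 1 ≤ k * b := Nat.mul_pos hk hb
  have henc : {T | IsKominoTower k n b T}.encard = (Nat.choose (k * n - 1) (n - b) : ℕ) := by
    rw [hset, Set.InjOn.encard_image, kGood_encard k hk, kCount_eq k hk _ _ (by omega)]
    · have : k * n = k * (n - b) + k * b := by rw [← mul_add, Nat.sub_add_cancel hbn]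
      congr 2
      omega
    · intro T hT T' hT' e
      have d := kGood_base_disj k b hk _ _ _ T hT
      have d' := kGood_base_disj k b hk _ _ _ T' hT'
      have e' := congrArg (fun S => S \ kBase k b) e
      simpa [Finset.union_sdiff_cancel_right d, Finset.union_sdiff_cancel_right d'] using e'
  have : Nat.card {T : Finset (ℤ × ℕ) // IsKominoTower k n b T}
      = {T | IsKominoTower k n b T}.ncard := rfl
  rw [this, Set.ncard, henc]
  simp
end

section
/- For all integers n ≥ b ≥ 2, the number of (n,b)-domino towers T satisfying the additional condition that (0,1) ∈ T (i.e., some level-1 domino has its left end in the column containing the left end of the leftmost base domino) equals C(2n−3, n−b−1), with the convention C(m, j) = 0 for j < 0. -/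
/-- The binomial coefficient `C(m, j)` with an integer lower index, extended by the convention
that it is `0` whenever `j < 0` (and, via `Nat.choose`, whenever `j > m`). -/
def binom (m : ℕ) (j : ℤ) : ℕ := if 0 ≤ j then m.choose j.toNat else 0

namespace Domino

/-- A set of pairwise non-overlapping positions. -/
def Indep (S : Finset ℤ) : Prop := ∀ x ∈ S, ∀ x' ∈ S, x ≠ x' → 2 ≤ |x - x'|

/-- Closed neighbourhood of a position. -/
noncomputable def nb (x : ℤ) : Finset ℤ := Finset.Icc (x - 1) (x + 1)

/-- Closed neighbourhood of a set of positions. -/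
noncomputable def NB (S : Finset ℤ) : Finset ℤ := S.biUnion nb

/-- Towers with base contained in `A`. -/
def IsT (A : Finset ℤ) (T : Finset (ℤ × ℕ)) : Prop :=
  (∀ x : ℤ, (x, 0) ∈ T → x ∈ A) ∧
  (∀ x x' : ℤ, ∀ y : ℕ, (x, y) ∈ T → (x', y) ∈ T → x ≠ x' → 2 ≤ |x - x'|) ∧
  (∀ x : ℤ, ∀ y : ℕ, (x, y + 1) ∈ T → ∃ x' : ℤ, (x', y) ∈ T ∧ |x - x'| ≤ 1)

/-- Type of towers over `A` with `m` pieces. -/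
abbrev Tow (A : Finset ℤ) (m : ℤ) : Type := {T : Finset (ℤ × ℕ) // IsT A T ∧ (T.card : ℤ) = m}

noncomputable def g (A : Finset ℤ) (m : ℤ) : ℕ := Nat.card (Tow A m)

def up : ℤ × ℕ ↪ ℤ × ℕ := ⟨fun p => (p.1, p.2 + 1), by
  rintro ⟨a, b⟩ ⟨c, d⟩ h; simpa using h⟩

def gd : ℤ ↪ ℤ × ℕ := ⟨fun x => (x, 0), by intro a b h; simpa using h⟩

noncomputable def build (S : Finset ℤ) (T : Finset (ℤ × ℕ)) : Finset (ℤ × ℕ) := S.map gd ∪ T.map up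

noncomputable def base (T : Finset (ℤ × ℕ)) : Finset ℤ := T.preimage gd gd.injective.injOn

noncomputable def rest (T : Finset (ℤ × ℕ)) : Finset (ℤ × ℕ) := T.preimage up up.injective.injOn

@[simp] lemma up_apply (x : ℤ) (y : ℕ) : up (x, y) = (x, y + 1) := rfl

@[simp] lemma gd_apply (x : ℤ) : gd x = (x, 0) := rfl

lemma mem_nb (x y : ℤ) : y ∈ nb x ↔ |y - x| ≤ 1 := by
  rw [nb, Finset.mem_Icc, abs_le]; constructor <;> rintro ⟨h1, h2⟩ <;> constructor <;> linarith

@[simp] lemma mem_base (T) (x : ℤ) : x ∈ base T ↔ (x, 0) ∈ T := by simp [base]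

@[simp] lemma mem_rest (T) (x : ℤ) (y : ℕ) : (x, y) ∈ rest T ↔ (x, y + 1) ∈ T := by simp [rest]

@[simp] lemma mem_build_zero (S T) (x : ℤ) : (x, 0) ∈ build S T ↔ x ∈ S := by
  simp [build]

@[simp] lemma mem_build_succ (S T) (x : ℤ) (y : ℕ) : (x, y + 1) ∈ build S T ↔ (x, y) ∈ T := by
  simp [build]

lemma build_base_rest (T) : build (base T) (rest T) = T := by
  ext ⟨x, y⟩
  cases y <;> simp

@[simp] lemma base_build (S T) : base (build S T) = S := by ext x; simp

@[simp] lemma rest_build (S T) : rest (build S T) = T := by ext ⟨x, y⟩; simp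

lemma card_build (S T) : (build S T).card = S.card + T.card := by
  rw [build, Finset.card_union_of_disjoint, Finset.card_map, Finset.card_map]
  rw [Finset.disjoint_left]
  rintro ⟨x, y⟩ h1 h2
  simp at h1 h2
  omega

lemma isT_build (A S T) : IsT A (build S T) ↔ S ⊆ A ∧ Indep S ∧ IsT (NB S) T := by
  constructor
  · rintro ⟨h1, h2, h3⟩
    refine ⟨fun x hx => h1 x (by simpa using hx), ?_, ?_, ?_, ?_⟩
    · intro x hx x' hx'
      exact h2 x x' 0 (by simpa using hx) (by simpa using hx')
    · intro x hx
      obtain ⟨x', h, h'⟩ := h3 x 0 (by rw [mem_build_succ]; exact hx)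
      rw [NB, Finset.mem_biUnion]
      exact ⟨x', by simpa using h, (mem_nb _ _).2 h'⟩
    · intro x x' y h h'
      exact h2 x x' (y + 1) (by simpa using h) (by simpa using h')
    · intro x y h
      obtain ⟨x', h, h'⟩ := h3 x (y + 1) (by rw [mem_build_succ]; exact h)
      exact ⟨x', by simpa using h, h'⟩
  · rintro ⟨h1, h2, h3, h4, h5⟩
    refine ⟨fun x hx => h1 (by simpa using hx), ?_, ?_⟩
    · intro x x' y h h'
      cases y with
      | zero => exact h2 x (by simpa using h) x' (by simpa using h')
      | succ y => exact h4 x x' y (by simpa using h) (by simpa using h')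
    · intro x y h
      rw [mem_build_succ] at h
      cases y with
      | zero =>
        have := h3 x h
        rw [NB, Finset.mem_biUnion] at this
        obtain ⟨x', h, h'⟩ := this
        exact ⟨x', by simpa using h, (mem_nb _ _).1 h'⟩
      | succ y =>
        obtain ⟨x', h, h'⟩ := h5 x y h
        exact ⟨x', by simpa using h, h'⟩

open Classical in
/-- Independent subsets. -/
noncomputable def ind (D : Finset ℤ) : Finset (Finset ℤ) := D.powerset.filter Indep

lemma mem_ind (D S) : S ∈ ind D ↔ S ⊆ D ∧ Indep S := by simp [ind]

noncomputable def levelEquiv (A : Finset ℤ) (m : ℤ) :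
    Tow A m ≃ Σ S : {S // S ∈ ind A}, Tow (NB S.1) (m - S.1.card) where
  toFun T := ⟨⟨base T.1, by
      have := T.2.1; rw [← build_base_rest T.1, isT_build] at this
      exact (mem_ind _ _).2 ⟨this.1, this.2.1⟩⟩, ⟨rest T.1, by
      have := T.2.1; rw [← build_base_rest T.1, isT_build] at this
      exact this.2.2, by
      have := T.2.2; rw [← build_base_rest T.1, card_build] at this
      push_cast at this; simp only; linarith⟩⟩
  invFun p := ⟨build p.1.1 p.2.1, by
      rw [isT_build]
      have := (mem_ind _ _).1 p.1.2
      exact ⟨this.1, this.2, p.2.2.1⟩, by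
      have := p.2.2.2
      rw [card_build]; push_cast; linarith⟩
  left_inv T := by simp [build_base_rest]
  right_inv := by
    rintro ⟨⟨S, hS⟩, ⟨T, hT⟩⟩
    have h1 : base (build S T) = S := base_build _ _
    have h2 : rest (build S T) = T := rest_build _ _
    refine Sigma.ext (Subtype.ext h1) ?_
    dsimp only
    rw! [h1, h2]
    rfl

lemma isT_empty (T) : IsT ∅ T ↔ T = ∅ := by
  constructor
  · rintro ⟨h1, -, h3⟩
    have : ∀ y x, (x, y) ∉ T := by
      intro y
      induction y with
      | zero => intro x h; simpa using h1 x h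
      | succ y ih => intro x h; obtain ⟨x', h, -⟩ := h3 x y h; exact ih x' h
    ext ⟨x, y⟩; simp [this]
  · rintro rfl
    refine ⟨?_, ?_, ?_⟩ <;> simp

instance finite_empty (m) : Finite (Tow ∅ m) := by
  have : Subsingleton (Tow ∅ m) := ⟨fun a b => Subtype.ext (by
    rw [(isT_empty _).1 a.2.1, (isT_empty _).1 b.2.1])⟩
  infer_instance

lemma tow_neg (A) (m : ℤ) (hm : m < 0) : IsEmpty (Tow A m) :=
  ⟨fun T => by have := T.2.2; omega⟩

lemma finite_aux (M : ℕ) : ∀ A, ∀ m : ℤ, m < M → Finite (Tow A m) := by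
  induction M with
  | zero => intro A m hm; have := tow_neg A m (by simpa using hm); infer_instance
  | succ M ih =>
    intro A m hm
    have : ∀ S : {S // S ∈ ind A}, Finite (Tow (NB S.1) (m - S.1.card)) := by
      intro S
      rcases S.1.eq_empty_or_nonempty with h | h
      · rw [h]; exact finite_empty _
      · apply ih
        have := Finset.card_pos.2 h
        push_cast at hm
        omega
    exact Finite.of_equiv _ (levelEquiv A m).symm

instance finite_tow (A m) : Finite (Tow A m) :=
  finite_aux (m.toNat + 1) A m (by omega)

lemma g_empty (m : ℤ) : g ∅ m = if m = 0 then 1 else 0 := by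
  split_ifs with h
  · subst h
    have : Unique (Tow ∅ 0) := ⟨⟨⟨∅, (isT_empty _).2 rfl, by simp⟩⟩, fun a => Subtype.ext
      ((isT_empty _).1 a.2.1)⟩
    exact Nat.card_unique
  · have : IsEmpty (Tow ∅ m) := ⟨fun T => by
      have h1 := (isT_empty _).1 T.2.1
      have h2 := T.2.2
      rw [h1] at h2; simp at h2; omega⟩
    exact Nat.card_of_isEmpty

lemma g_neg (A) (m : ℤ) (hm : m < 0) : g A m = 0 := by
  have := tow_neg A m hm
  exact Nat.card_of_isEmpty

/-- The sum operator. -/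
noncomputable def L (P D : Finset ℤ) (m : ℤ) : ℕ := ∑ V ∈ ind D, g (P ∪ NB V) (m - V.card)

lemma g_eq_L (A m) : g A m = L ∅ A m := by
  rw [g, Nat.card_congr (levelEquiv A m), Nat.card_sigma, L]
  simp only [Finset.empty_union, g]
  exact Finset.sum_coe_sort (ind A) (fun V => Nat.card (Tow (NB V) (m - V.card)))

lemma indep_insert (y : ℤ) (V : Finset ℤ) (hy : y ∉ V) :
    Indep (insert y V) ↔ Indep V ∧ Disjoint V (nb y) := by
  rw [Finset.disjoint_left]
  constructor
  · intro h
    refine ⟨fun x hx x' hx' => h x (by simp [hx]) x' (by simp [hx']), fun x hx h' => ?_⟩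
    have := h x (by simp [hx]) y (by simp) (by rintro rfl; exact hy hx)
    rw [mem_nb] at h'
    omega
  · rintro ⟨h1, h2⟩ x hx x' hx' hne
    rw [Finset.mem_insert] at hx hx'
    have key : ∀ z ∈ V, 2 ≤ |z - y| := by
      intro z hz; have := h2 hz; rw [mem_nb] at this; omega
    rcases hx with rfl | hx <;> rcases hx' with rfl | hx'
    · exact absurd rfl hne
    · rw [abs_sub_comm]; exact key _ hx'
    · exact key _ hx
    · exact h1 x hx x' hx' hne

lemma L_insert (P D : Finset ℤ) (y : ℤ) (hy : y ∉ D) (m : ℤ) :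
    L P (insert y D) m = L P D m + L (P ∪ nb y) (D \ nb y) (m - 1) := by
  classical
  have hyn : y ∈ nb y := by rw [mem_nb]; simp
  have h : ind (insert y D) = ind D ∪ (ind (D \ nb y)).image (insert y) := by
    ext S
    rw [Finset.mem_union, Finset.mem_image, mem_ind, mem_ind]
    constructor
    · rintro ⟨h1, h2⟩
      by_cases hS : y ∈ S
      · right
        refine ⟨S.erase y, ?_, Finset.insert_erase hS⟩
        rw [← Finset.insert_erase hS, indep_insert _ _ (by simp)] at h2
        rw [mem_ind, Finset.subset_sdiff]
        refine ⟨⟨?_, h2.2⟩, h2.1⟩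
        exact Finset.subset_insert_iff.1 h1
      · left
        exact ⟨(Finset.subset_insert_iff_of_notMem hS).1 h1, h2⟩
    · rintro (⟨h1, h2⟩ | ⟨V, hV, rfl⟩)
      · exact ⟨h1.trans (Finset.subset_insert _ _), h2⟩
      · rw [mem_ind, Finset.subset_sdiff] at hV
        have hyV : y ∉ V := fun h => hy (hV.1.1 h)
        exact ⟨Finset.insert_subset_insert _ hV.1.1, (indep_insert _ _ hyV).2 ⟨hV.2, hV.1.2⟩⟩
  have hmem : ∀ V ∈ ind (D \ nb y), y ∉ V := by
    intro V hV h
    have := ((mem_ind _ _).1 hV).1 h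
    simp [hyn] at this
  rw [L, h, Finset.sum_union, Finset.sum_image]
  · congr 1
    apply Finset.sum_congr rfl
    intro V hV
    rw [Finset.card_insert_of_notMem (hmem V hV)]
    congr 1
    · rw [NB, Finset.biUnion_insert, Finset.union_assoc, NB]
    · push_cast; ring
  · intro V hV W hW h
    have := congrArg (fun Z => Finset.erase Z y) h
    simpa [Finset.erase_insert (hmem V hV), Finset.erase_insert (hmem W hW)] using this
  · rw [Finset.disjoint_left]
    intro S hS hS'
    rw [Finset.mem_image] at hS'
    obtain ⟨V, -, rfl⟩ := hS'
    exact hy (((mem_ind _ _).1 hS).1 (by simp))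

lemma L_empty (P m) : L P ∅ m = g P m := by
  have : ind ∅ = {∅} := by
    ext S; rw [mem_ind, Finset.subset_empty, Finset.mem_singleton]
    constructor
    · exact fun h => h.1
    · rintro rfl; exact ⟨rfl, by simp [Indep]⟩
  simp [L, this, NB]

lemma sum_aux (M : ℕ) : ∀ m : ℤ, m < M → ∀ k : ℕ, ∀ P D : Finset ℤ, D.card = k → Disjoint P D →
    g (P ∪ D) m = L P D m := by
  induction M with
  | zero =>
    intro m hm k P D _ _
    rw [g_neg _ _ (by simpa using hm), L]
    symm
    apply Finset.sum_eq_zero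
    intro V _
    apply g_neg
    simp at hm
    omega
  | succ M ih =>
    intro m hm k
    push_cast at hm
    induction k with
    | zero =>
      intro P D hD _
      rw [Finset.card_eq_zero] at hD
      subst hD
      rw [L_empty, Finset.union_empty]
    | succ k ihk =>
      intro P D hD hPD
      obtain ⟨y, D, hy, rfl, hk⟩ := Finset.card_eq_succ.1 hD
      rw [Finset.disjoint_insert_right] at hPD
      have hy' : y ∉ P ∪ D := by simp [hPD.1, hy]
      rw [L_insert _ _ _ hy, ← ihk P D hk hPD.2, Finset.union_insert, g_eq_L,
        L_insert _ _ _ hy', ← g_eq_L, ← ih (m - 1) (by omega) _ _ _ rfl,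
        ← ih (m - 1) (by omega) _ _ _ rfl]
      · congr 2
        ext z; simp; tauto
      · rw [Finset.disjoint_left] at *
        intro z hz hz'
        have hd := hPD.2
        have := @hd z
        simp at hz hz'
        tauto
      · rw [Finset.disjoint_left]
        intro z hz hz'
        simp at hz hz'
        tauto

lemma step (A : Finset ℤ) (x : ℤ) (hx : x ∉ A) (m : ℤ) :
    g (insert x A) m = g A m + g (A ∪ nb x) (m - 1) := by
  rw [g_eq_L, L_insert _ _ _ hx, ← g_eq_L, ← sum_aux ((m-1).toNat + 1) (m-1) (by omega) _ _ _ rfl]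
  · congr 2
    ext z; simp; tauto
  · rw [Finset.disjoint_left]
    intro z hz hz'
    simp at hz hz'
    tauto

lemma g_interval (m : ℕ) : ∀ k : ℕ, ∀ a : ℤ,
    g (Finset.Icc a (a + k)) m = (2 * m + k - 1).choose m := by
  induction m with
  | zero =>
    intro k a
    have : ∀ A : Finset ℤ, g A (0 : ℕ) = 1 := by
      intro A
      induction A using Finset.induction_on with
      | empty => rw [g_empty]; simp
      | insert x A hx ih => rw [step _ _ hx, ih, g_neg _ _ (by simp)]
    rw [this]; simp
  | succ m ih =>
    intro k
    induction k with
    | zero =>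
      intro a
      have h : Finset.Icc a (a + (0 : ℕ)) = insert a ∅ := by simp
      rw [h, step _ _ (by simp), g_empty, if_neg (by omega)]
      have h2 : ∅ ∪ nb a = Finset.Icc (a - 1) (a - 1 + (2 : ℕ)) := by
        rw [Finset.empty_union, nb]; congr 1; push_cast; ring
      have h3 : ((m + 1 : ℕ) : ℤ) - 1 = m := by push_cast; ring
      rw [h2, h3, ih]
      have e1 : 2 * m + 2 - 1 = 2 * m + 1 := by omega
      have e2 : 2 * (m + 1) + 0 - 1 = 2 * m + 1 := by omega
      rw [e1, e2, zero_add]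
      exact Nat.choose_symm_of_eq_add (by omega)
    | succ k ihk =>
      intro a
      have h : Finset.Icc a (a + (k + 1 : ℕ)) = insert (a + k + 1) (Finset.Icc a (a + k)) := by
        ext z; simp; omega
      have h2 : Finset.Icc a (a + k) ∪ nb (a + k + 1) = Finset.Icc a (a + (k + 2 : ℕ)) := by
        ext z; simp [nb]; omega
      have h3 : ((m + 1 : ℕ) : ℤ) - 1 = m := by push_cast; ring
      rw [h, step _ _ (by simp), h2, h3, ih, ihk]
      have e1 : 2 * m + (k + 2) - 1 = 2 * m + k + 1 := by omega
      have e2 : 2 * (m + 1) + (k + 1) - 1 = 2 * m + k + 1 + 1 := by omega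
      have e3 : 2 * (m + 1) + k - 1 = 2 * m + k + 1 := by omega
      rw [e1, e2, e3, Nat.choose_succ_succ (2 * m + k + 1) m, add_comm]

/-- Towers over `A` containing `(x,0)`. -/
lemma card_with (A : Finset ℤ) (x : ℤ) (hx : x ∈ A) (m : ℤ) :
    Nat.card {T : Tow A m // (x, 0) ∈ T.1} = g (A ∪ nb x) (m - 1) := by
  classical
  have h1 : g A m = Nat.card {T : Tow A m // (x, 0) ∈ T.1} +
      Nat.card {T : Tow A m // ¬ (x, 0) ∈ T.1} := by
    rw [← Nat.card_sum, g]
    exact Nat.card_congr (Equiv.sumCompl _).symm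
  have h2 : Nat.card {T : Tow A m // ¬ (x, 0) ∈ T.1} = g (A.erase x) m := by
    refine Nat.card_congr ⟨fun T => ⟨T.1.1, ⟨?_, T.1.2.1.2⟩, T.1.2.2⟩,
      fun T => ⟨⟨T.1, ⟨?_, T.2.1.2⟩, T.2.2⟩, ?_⟩, fun _ => rfl, fun _ => rfl⟩
    · intro z hz
      rw [Finset.mem_erase]
      exact ⟨fun h => T.2 (h ▸ hz), T.1.2.1.1 z hz⟩
    · intro z hz
      exact Finset.mem_of_mem_erase (T.2.1.1 z hz)
    · intro h
      simpa using T.2.1.1 x h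
  have h3 := step (A.erase x) x (by simp) m
  rw [Finset.insert_erase hx] at h3
  have h4 : A.erase x ∪ nb x = A ∪ nb x := by
    have : x ∈ nb x := by rw [mem_nb]; simp
    ext z
    by_cases h : z = x
    · subst h; simp [this]
    · simp [h]
  rw [h4] at h3
  omega

/-- The convex base. -/
def cb (b : ℕ) : Finset ℤ := (Finset.range b).image (fun i : ℕ => 2 * (i : ℤ))

lemma mem_cb (b x) : x ∈ cb b ↔ ∃ i : ℕ, i < b ∧ x = 2 * (i : ℤ) := by
  simp [cb, eq_comm]

lemma card_cb (b) : (cb b).card = b := by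
  rw [cb, Finset.card_image_of_injective, Finset.card_range]
  intro i j h; simpa using h

lemma indep_cb (b) : Indep (cb b) := by
  intro x hx y hy h
  rw [mem_cb] at hx hy
  obtain ⟨i, _, rfl⟩ := hx
  obtain ⟨j, _, rfl⟩ := hy
  rw [le_abs]
  omega

lemma NB_cb (b : ℕ) (hb : 1 ≤ b) : NB (cb b) = Finset.Icc (-1 : ℤ) (-1 + (2 * b : ℕ)) := by
  ext z
  simp only [NB, Finset.mem_biUnion, mem_cb, nb, Finset.mem_Icc]
  constructor
  · rintro ⟨_, ⟨i, hi, rfl⟩, h⟩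
    push_cast; omega
  · rintro ⟨h1, h2⟩
    push_cast at h2
    by_cases hz : z = -1
    · exact ⟨0, ⟨0, by omega, by simp⟩, by omega⟩
    · exact ⟨_, ⟨(z / 2).toNat, by omega, rfl⟩, by omega⟩

lemma tower_iff (n b : ℕ) (T) :
    IsDominoTower n b T ↔ T.card = n ∧ base T = cb b ∧ IsT (base T) T := by
  have hbase : base T = cb b ↔ ∀ x : ℤ, (x, 0) ∈ T ↔ ∃ i : ℕ, i < b ∧ x = 2 * (i : ℤ) := by
    rw [Finset.ext_iff]; simp only [mem_base, mem_cb]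
  rw [hbase, IsDominoTower, IsT]
  simp

lemma tower_build (n b : ℕ) (T) :
    IsDominoTower n b (build (cb b) T) ↔ IsT (NB (cb b)) T ∧ (T.card : ℤ) = n - b := by
  rw [tower_iff, base_build, isT_build, card_build, card_cb]
  constructor
  · rintro ⟨h1, -, -, -, h2⟩
    exact ⟨h2, by omega⟩
  · rintro ⟨h1, h2⟩
    exact ⟨by omega, rfl, subset_rfl, indep_cb b, h1⟩

lemma tower_eq (n b : ℕ) (T) (h : IsDominoTower n b T) : build (cb b) (rest T) = T := by
  rw [← ((tower_iff _ _ _).1 h).2.1, build_base_rest]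

noncomputable def mainEquiv (n b : ℕ) :
    {T : Finset (ℤ × ℕ) // IsDominoTower n b T ∧ ((0 : ℤ), 1) ∈ T} ≃
      {T : Tow (NB (cb b)) (n - b) // ((0 : ℤ), 0) ∈ T.1} where
  toFun T := ⟨⟨rest T.1, (tower_build n b _).1 (by rw [tower_eq n b _ T.2.1]; exact T.2.1)⟩, by
    rw [mem_rest]; exact T.2.2⟩
  invFun T := ⟨build (cb b) T.1.1, (tower_build n b _).2 T.1.2,
    (mem_build_succ _ _ 0 0).2 T.2⟩
  left_inv T := Subtype.ext (tower_eq n b _ T.2.1)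
  right_inv T := Subtype.ext (Subtype.ext (rest_build _ _))

end Domino

theorem domino_tower_count_B (n b : ℕ) (hb : 2 ≤ b) (hbn : b ≤ n) :
    Nat.card {T : Finset (ℤ × ℕ) // IsDominoTower n b T ∧ ((0 : ℤ), 1) ∈ T} =
      binom (2 * n - 3) ((n : ℤ) - b - 1) := by
  rw [Nat.card_congr (Domino.mainEquiv n b), Domino.NB_cb b (by omega),
    Domino.card_with _ 0 (by simp; omega)]
  have h : Finset.Icc (-1 : ℤ) (-1 + (2 * b : ℕ)) ∪ Domino.nb 0 =
      Finset.Icc (-1 : ℤ) (-1 + (2 * b : ℕ)) := by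
    ext z; simp [Domino.nb]; omega
  rw [h, binom]
  split_ifs with h0
  · obtain ⟨m, hm⟩ := Int.eq_ofNat_of_zero_le h0
    rw [hm]
    rw [Domino.g_interval, Int.toNat_natCast]
    congr 1
    omega
  · exact Domino.g_neg _ _ (by omega)
end
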